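/- arXiv:1112.2742 — 12 statements merged into one kernel-verified Lean document; each statement's English description precedes it below -/
import Mathlib

section
/- For every integer b ≥ 2, ∑_{k=2}^{b} (k−1) · C(b,k) · (k−2)!(b−k)!/(b−1)! = b · ∑_{k=2}^{b} 1/k. -/
/-- For `b ≥ 2`, `∑_{k=2}^{b} (k−1)·C(b,k)·(k−2)!(b−k)!/(b−1)! = b·∑_{k=2}^{b} 1/k`. -/
theorem stmt2 (b : ℕ) (hb : 2 ≤ b) :
    ∑ k ∈ Finset.Icc 2 b, ((k : ℝ) - 1) * (b.choose k : ℝ) *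
        ((k - 2).factorial * (b - k).factorial / (b - 1).factorial : ℝ)
      = (b : ℝ) * ∑ k ∈ Finset.Icc 2 b, (1 : ℝ) / (k : ℝ) := by
  rw [Finset.mul_sum]
  refine Finset.sum_congr rfl fun k hk => ?_
  obtain ⟨h2, hkb⟩ := Finset.mem_Icc.mp hk
  have hc : (b.choose k : ℝ) * k.factorial * (b - k).factorial = b.factorial := by
    exact_mod_cast Nat.choose_mul_factorial_mul_factorial hkb
  obtain ⟨m, rfl⟩ : ∃ m, k = m + 2 := ⟨k - 2, by omega⟩
  obtain ⟨c, rfl⟩ : ∃ c, b = c + 1 := ⟨b - 1, by omega⟩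
  have e1 : m + 2 - 2 = m := by omega
  have e2 : c + 1 - 1 = c := by omega
  rw [e1, e2]
  have hf : (c.factorial : ℝ) ≠ 0 := by exact_mod_cast c.factorial_ne_zero
  have hm : ((m + 2 : ℕ) : ℝ) ≠ 0 := by positivity
  rw [Nat.factorial_succ c, Nat.factorial_succ (m + 1), Nat.factorial_succ m] at hc
  field_simp
  push_cast at hc ⊢
  linear_combination hc
end

section
/- Let ε_n = exp(−√(log n)). For all integers n and b with 2 ≤ b ≤ n, |∫_0^{ε_n/log n} (b·y − 1 + (1−y)^b) y^(−2) dy − b·(log b − log log n + log ε_n + γ − 1)| ≤ (log n)/ε_n + 1, where γ denotes Euler's constant. -/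
open Finset in
lemma aux_integrand (b : ℕ) (y : ℝ) (hy : y ≠ 0) :
    ((b : ℝ) * y - 1 + (1 - y) ^ b) / y ^ 2
      = ∑ j ∈ range b, ∑ k ∈ range j, (1 - y) ^ k := by
  induction b with
  | zero => simp
  | succ b ih =>
    rw [sum_range_succ, ← ih]
    have h := geom_sum_mul (1 - y) b
    have h2 : ∑ k ∈ range b, (1 - y) ^ k = (1 - (1 - y) ^ b) / y := by
      rw [eq_div_iff hy]; linarith
    rw [h2]
    field_simp
    push_cast
    ring

open Finset in
lemma aux_closed (c : ℝ) (b : ℕ) :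
    ∑ j ∈ range b, ∑ k ∈ range j, (1 - c ^ (k + 1)) / ((k : ℝ) + 1)
      = b * (harmonic b : ℝ) - b - b * (∑ i ∈ range b, c ^ (i + 1) / ((i : ℝ) + 1))
        + ∑ i ∈ range b, c ^ (i + 1) := by
  have hs : ∀ j : ℕ, ∑ k ∈ range j, (1 - c ^ (k + 1)) / ((k : ℝ) + 1)
      = (harmonic j : ℝ) - ∑ i ∈ range j, c ^ (i + 1) / ((i : ℝ) + 1) := by
    intro j
    rw [harmonic]
    push_cast
    rw [← sum_sub_distrib]
    refine sum_congr rfl fun i _ => ?_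
    rw [sub_div, one_div]
  induction b with
  | zero => simp
  | succ b ih =>
    rw [sum_range_succ, ih, hs, harmonic_succ, sum_range_succ, sum_range_succ]
    have : (b : ℝ) + 1 ≠ 0 := by positivity
    push_cast
    field_simp
    ring

open Finset in
lemma aux_integral (b : ℕ) (a : ℝ) (ha : 0 ≤ a) :
    ∫ y in Set.Ioc (0:ℝ) a, ((b : ℝ) * y - 1 + (1 - y) ^ b) / y ^ 2
      = ∑ j ∈ range b, ∑ k ∈ range j, (1 - (1 - a) ^ (k + 1)) / ((k : ℝ) + 1) := by
  rw [MeasureTheory.setIntegral_congr_fun measurableSet_Ioc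
    (fun y hy => aux_integrand b y hy.1.ne'), ← intervalIntegral.integral_of_le ha]
  rw [intervalIntegral.integral_finsetSum]
  · refine sum_congr rfl fun j _ => ?_
    rw [intervalIntegral.integral_finsetSum]
    · refine sum_congr rfl fun k _ => ?_
      rw [intervalIntegral.integral_comp_sub_left (fun y => y ^ k) 1, integral_pow]
      simp
    · intro k _
      exact Continuous.intervalIntegrable (by fun_prop) _ _
  · intro j _
    exact Continuous.intervalIntegrable (by fun_prop) _ _

open Finset in
lemma aux_tail (c : ℝ) (h0 : 0 ≤ c) (h1 : c < 1) (b : ℕ) :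
    0 ≤ -Real.log (1 - c) - ∑ i ∈ range b, c ^ (i + 1) / ((i : ℝ) + 1) ∧
    b * (-Real.log (1 - c) - ∑ i ∈ range b, c ^ (i + 1) / ((i : ℝ) + 1))
      ≤ c ^ (b + 1) * (1 - c)⁻¹ := by
  have h := Real.hasSum_pow_div_log_of_abs_lt_one (x := c) (by rwa [abs_of_nonneg h0])
  have ht := (hasSum_nat_add_iff' b).2 h
  refine ⟨ht.nonneg fun i => by positivity, ?_⟩
  refine hasSum_le (fun i => ?_) (ht.mul_left (b : ℝ))
    ((hasSum_geometric_of_lt_one h0 h1).mul_left (c ^ (b + 1)))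
  push_cast
  rw [← mul_div_assoc, div_le_iff₀ (by positivity)]
  have e : c ^ (b + 1) * c ^ i = c ^ (i + b + 1) := by ring
  rw [e]
  have : 0 ≤ c ^ (i + b + 1) := by positivity
  nlinarith [mul_nonneg this (Nat.cast_nonneg (α := ℝ) i)]

open Finset in
lemma aux_main (b : ℕ) (hb : 2 ≤ b) (a : ℝ) (ha : 0 < a) (ha1 : a ≤ 1) :
    |(∫ y in Set.Ioc (0:ℝ) a, ((b : ℝ) * y - 1 + (1 - y) ^ b) / y ^ 2)
      - b * (Real.log b + Real.log a + Real.eulerMascheroniConstant - 1)| ≤ a⁻¹ := by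
  rw [aux_integral b a ha.le, aux_closed]
  obtain ⟨t0, t1⟩ := aux_tail (1 - a) (by linarith) (by linarith) b
  have hb0 : (0:ℝ) < b := by positivity
  have g1 : Real.eulerMascheroniConstant ≤ harmonic b - Real.log b := by
    have := Real.eulerMascheroniConstant_lt_eulerMascheroniSeq' b
    rw [Real.eulerMascheroniSeq', if_neg (by omega)] at this
    exact this.le
  have g2 : b * (harmonic b - Real.log b - Real.eulerMascheroniConstant) ≤ 1 := by
    obtain ⟨m, rfl⟩ : ∃ m, b = m + 1 := ⟨b - 1, by omega⟩
    have := Real.eulerMascheroniSeq_lt_eulerMascheroniConstant m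
    rw [Real.eulerMascheroniSeq] at this
    rw [harmonic_succ]
    push_cast at hb0 ⊢
    have e : ((m:ℝ) + 1) * ((m:ℝ) + 1)⁻¹ = 1 := mul_inv_cancel₀ hb0.ne'
    nlinarith
  have g1' : 0 ≤ b * (harmonic b - Real.log b - Real.eulerMascheroniConstant) :=
    mul_nonneg hb0.le (by linarith)
  have t0' := mul_nonneg hb0.le t0
  have hc : 0 ≤ 1 - a := by linarith
  have s0 : 0 ≤ ∑ i ∈ range b, (1 - a) ^ (i + 1) := sum_nonneg fun i _ => by positivity
  have s1 : ∑ i ∈ range b, (1 - a) ^ (i + 1) = a⁻¹ - 1 - (1 - a) ^ (b + 1) * a⁻¹ := by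
    have h := geom_sum_mul (1 - a) b
    simp_rw [pow_succ, ← sum_mul]
    have h2 : ∑ k ∈ range b, (1 - a) ^ k = (1 - (1 - a) ^ b) / a := by
      rw [eq_div_iff ha.ne']; linarith
    rw [h2]
    field_simp
  rw [sub_sub_cancel] at t0' t1
  rw [abs_le]
  have : 0 < a⁻¹ := by positivity
  constructor
  · nlinarith
  · rw [s1]; nlinarith

theorem stmt5 (n b : ℕ) (hb : 2 ≤ b) (hbn : b ≤ n) :
    |(∫ y in Set.Ioc (0:ℝ) (Real.exp (-Real.sqrt (Real.log n)) / Real.log n),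
          ((b : ℝ) * y - 1 + (1 - y) ^ b) / y ^ 2)
        - (b : ℝ) * (Real.log b - Real.log (Real.log n)
            + Real.log (Real.exp (-Real.sqrt (Real.log n)))
            + Real.eulerMascheroniConstant - 1)|
      ≤ Real.log n / Real.exp (-Real.sqrt (Real.log n)) + 1 := by
  have hL : (0.69:ℝ) ≤ Real.log n := by
    have h2 : (2:ℝ) ≤ n := by exact_mod_cast hb.trans hbn
    have := Real.log_le_log (by norm_num) h2
    linarith [Real.log_two_gt_d9]
  have hL0 : 0 < Real.log n := by linarith
  have hs : (0.8:ℝ) ≤ Real.sqrt (Real.log n) := Real.le_sqrt_of_sq_le (by norm_num; linarith)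
  have he := Real.exp_pos (-Real.sqrt (Real.log n))
  have h1 : Real.exp (-Real.sqrt (Real.log n)) / Real.log n ≤ 1 := by
    rw [div_le_one hL0, Real.exp_neg, inv_le_comm₀ (Real.exp_pos _) hL0]
    have := Real.add_one_le_exp (Real.sqrt (Real.log n))
    have h3 : (Real.log n)⁻¹ ≤ 0.69⁻¹ := by gcongr
    norm_num at h3 hs
    linarith
  have := aux_main b hb _ (by positivity) h1
  rw [Real.log_div he.ne' hL0.ne', inv_div] at this
  have e : Real.log b - Real.log (Real.log n)
            + Real.log (Real.exp (-Real.sqrt (Real.log n)))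
      = Real.log b + (Real.log (Real.exp (-Real.sqrt (Real.log n))) - Real.log (Real.log n)) := by
    ring
  rw [e]
  linarith
end

section
/- Let ε_n = exp(−√(log n)). For all integers n and b with 2 ≤ b ≤ n, ∑_{k=2}^{b} (k−1)² · C(b,k) · ∫_0^{ε_n/log n} x^(k−2)(1−x)^(b−k) dx ≤ b² ε_n / log n. -/
theorem aux_le_one (n : ℕ) (hn : 2 ≤ n) :
    0 ≤ Real.exp (-Real.sqrt (Real.log n)) / Real.log n ∧
    Real.exp (-Real.sqrt (Real.log n)) / Real.log n ≤ 1 := by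
  have hl : 0.6931 ≤ Real.log n := by
    have h1 : Real.log 2 ≤ Real.log n := Real.log_le_log (by norm_num) (by exact_mod_cast hn)
    have := Real.log_two_gt_d9
    linarith
  have hpos : 0 < Real.log n := by linarith
  refine ⟨by positivity, ?_⟩
  rw [div_le_one hpos]
  have hs : 0.8 ≤ Real.sqrt (Real.log n) := Real.le_sqrt_of_sq_le (by norm_num; linarith)
  have h2 := Real.add_one_le_exp (Real.sqrt (Real.log n))
  rw [Real.exp_neg]
  apply inv_le_of_inv_le₀ hpos
  rw [inv_le_iff_one_le_mul₀ hpos]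
  nlinarith

theorem aux_choose (m j : ℕ) :
    ((j : ℝ) + 2) * (j + 1) * ((m + 2).choose (j + 2) : ℝ) = (m + 2) * (m + 1) * (m.choose j : ℝ) := by
  have h1 := Nat.add_one_mul_choose_eq m j
  have h2 := Nat.add_one_mul_choose_eq (m + 1) (j + 1)
  have h1' : ((m : ℝ) + 1) * (m.choose j : ℝ) = ((m + 1).choose (j + 1) : ℝ) * (j + 1) := by
    exact_mod_cast h1
  have h2' : ((m : ℝ) + 1 + 1) * ((m + 1).choose (j + 1) : ℝ)
      = ((m + 2).choose (j + 2) : ℝ) * (j + 1 + 1) := by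
    exact_mod_cast h2
  linear_combination (-(m : ℝ) - 2) * h1' - (j + 1 : ℝ) * h2'

/-- With `ε_n = exp(−√(log n))`, for `2 ≤ b ≤ n`,
`∑_{k=2}^{b} (k−1)²·C(b,k)·∫_0^{ε_n/log n} x^(k−2)(1−x)^(b−k) dx ≤ b² ε_n / log n`. -/
theorem stmt6 (n b : ℕ) (hb : 2 ≤ b) (hbn : b ≤ n) :
    ∑ k ∈ Finset.Icc 2 b, ((k : ℝ) - 1) ^ 2 * (b.choose k : ℝ) *
        ∫ x in (0:ℝ)..(Real.exp (-Real.sqrt (Real.log n)) / Real.log n),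
          x ^ (k - 2) * (1 - x) ^ (b - k)
      ≤ (b : ℝ) ^ 2 * Real.exp (-Real.sqrt (Real.log n)) / Real.log n := by
  obtain ⟨h0, h1⟩ := aux_le_one n (hb.trans hbn)
  rw [mul_div_assoc]
  generalize Real.exp (-Real.sqrt (Real.log n)) / Real.log n = a at *
  obtain ⟨m, rfl⟩ := Nat.exists_eq_add_of_le' hb
  have hI : Finset.Icc 2 (m + 2) = (Finset.range (m + 1)).map (addRightEmbedding 2) := by
    ext k
    simp only [Finset.mem_Icc, Finset.mem_map, Finset.mem_range, addRightEmbedding_apply]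
    constructor
    · intro h
      exact ⟨k - 2, by omega, by omega⟩
    · rintro ⟨j, hj, rfl⟩
      omega
  rw [hI, Finset.sum_map]
  have hsum : ∑ j ∈ Finset.range (m + 1), (m.choose j : ℝ) *
      ∫ x in (0:ℝ)..a, x ^ j * (1 - x) ^ (m - j) = a := by
    simp_rw [← intervalIntegral.integral_const_mul]
    rw [← intervalIntegral.integral_finsetSum]
    · have : ∀ x : ℝ, ∑ j ∈ Finset.range (m + 1), (m.choose j : ℝ) * (x ^ j * (1 - x) ^ (m - j)) = 1 := by
        intro x
        have h := add_pow x (1 - x) m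
        rw [add_sub_cancel, one_pow] at h
        refine Eq.trans ?_ h.symm
        exact Finset.sum_congr rfl fun j _ => by ring
      simp_rw [this]
      simp
    · intro j _
      exact Continuous.intervalIntegrable (by fun_prop) _ _
  calc _ ≤ ∑ j ∈ Finset.range (m + 1), ((m : ℝ) + 2) * (m + 1) * ((m.choose j : ℝ) *
      ∫ x in (0:ℝ)..a, x ^ j * (1 - x) ^ (m - j)) := by
        apply Finset.sum_le_sum
        intro j _
        simp only [addRightEmbedding_apply, Nat.add_sub_cancel, Nat.add_sub_add_right]
        rw [← mul_assoc, ← aux_choose]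
        apply mul_le_mul_of_nonneg_right
        · apply mul_le_mul_of_nonneg_right _ (Nat.cast_nonneg _)
          push_cast
          have : (0 : ℝ) ≤ j := Nat.cast_nonneg _
          nlinarith
        · apply intervalIntegral.integral_nonneg h0
          intro x hx
          have : 0 ≤ 1 - x := by linarith [hx.2]
          have := hx.1
          positivity
    _ = ((m : ℝ) + 2) * (m + 1) * a := by rw [← Finset.mul_sum, hsum]
    _ ≤ _ := by
        apply mul_le_mul_of_nonneg_right _ h0
        push_cast
        have : (0 : ℝ) ≤ m := Nat.cast_nonneg _
        nlinarith
end

section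
/- In a random recursive tree on n vertices, the expected total depth satisfies E[D_n] = n · (∑_{k=1}^{n} 1/k − 1). -/
open MeasureTheory ProbabilityTheory

/-- In a random recursive tree on `n` vertices (modeled via independent attachment
choices `U_k` uniform on `{1,…,k−1}` and depths `d_1 = 0`, `d_k = d_{U_k} + 1`),
the expected total depth satisfies `E[D_n] = n·(∑_{k=1}^{n} 1/k − 1)`. -/
theorem stmt7 (n : ℕ) (hn : 1 ≤ n)
    (Ω : Type*) [MeasurableSpace Ω] (P : Measure Ω) [IsProbabilityMeasure P]
    (U : ℕ → Ω → ℕ) (hUmeas : ∀ k, Measurable (U k))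
    (hUrange : ∀ k, 2 ≤ k → k ≤ n → ∀ ω, U k ω ∈ Finset.Icc 1 (k - 1))
    (hUunif : ∀ k, 2 ≤ k → k ≤ n → ∀ j ∈ Finset.Icc 1 (k - 1),
      P {ω | U k ω = j} = ((k - 1 : ℕ) : ENNReal)⁻¹)
    (hUindep : iIndepFun
      (fun k : {k : ℕ // 2 ≤ k ∧ k ≤ n} => U k.1) P)
    (d : ℕ → Ω → ℕ) (hdmeas : ∀ k, Measurable (d k))
    (hd1 : ∀ ω, d 1 ω = 0)
    (hdrec : ∀ k, 2 ≤ k → k ≤ n → ∀ ω, d k ω = d (U k ω) ω + 1) :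
    ∫ ω, (∑ k ∈ Finset.Icc 1 n, (d k ω : ℝ)) ∂P
      = (n : ℝ) * (∑ k ∈ Finset.Icc 1 n, (1 : ℝ) / (k : ℝ) - 1) := by
  -- bound
  have hbd : ∀ k, 1 ≤ k → k ≤ n → ∀ ω, d k ω ≤ k := by
    intro k
    induction k using Nat.strong_induction_on with
    | _ k ih =>
      intro h1 h2 ω
      rcases Nat.lt_or_ge k 2 with h | h
      · obtain rfl : k = 1 := by omega
        simp [hd1]
      · have hr := Finset.mem_Icc.1 (hUrange k h h2 ω)
        have := ih (U k ω) (by omega) (by omega) (by omega) ω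
        rw [hdrec k h h2]
        omega
  have hdet : ∀ k, 1 ≤ k → k ≤ n → ∀ ω ω', (∀ i, 2 ≤ i → i ≤ k → U i ω = U i ω') →
      d k ω = d k ω' := by
    intro k
    induction k using Nat.strong_induction_on with
    | _ k ih =>
      intro h1 h2 ω ω' he
      rcases Nat.lt_or_ge k 2 with h | h
      · obtain rfl : k = 1 := by omega
        simp [hd1]
      · have hr := Finset.mem_Icc.1 (hUrange k h h2 ω)
        rw [hdrec k h h2, hdrec k h h2, ← he k h le_rfl]
        rw [ih (U k ω) (by omega) (by omega) (by omega) ω ω'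
          (fun i hi hi' => he i hi (by omega))]
  have hind : ∀ j k, 1 ≤ j → j < k → k ≤ n → IndepFun (d j) (U k) P := by
    intro j k hj hjk hk
    classical
    haveI : Fintype {k : ℕ // 2 ≤ k ∧ k ≤ n} :=
      Fintype.ofFinset (p := fun k => 2 ≤ k ∧ k ≤ n) (Finset.Icc 2 n)
        (fun x => by simp only [Finset.mem_Icc]; rfl)
    let S : Finset {k : ℕ // 2 ≤ k ∧ k ≤ n} := Finset.univ.filter (fun i => i.1 ≤ j)
    let kk : {k : ℕ // 2 ≤ k ∧ k ≤ n} := ⟨k, by omega, hk⟩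
    have hdisj : Disjoint S {kk} := by
      rw [Finset.disjoint_singleton_right]
      simp [S, kk]
      omega
    have h := hUindep.indepFun_finset S {kk} hdisj (fun i => hUmeas i.1)
    let F : Ω → (S → ℕ) := fun ω i => U i.1.1 ω
    have hfac : Function.FactorsThrough (d j) F := by
      intro ω ω' hF
      apply hdet j hj (by omega)
      intro i hi hij
      exact congrFun hF ⟨⟨i, hi, by omega⟩, by simp [S, hij]⟩
    have hm1 : Measurable (Function.extend F (d j) 0) := measurable_of_countable _
    have hm2 : Measurable (fun x : (({kk} : Finset _) → ℕ) =>
      x ⟨kk, Finset.mem_singleton_self _⟩) := measurable_pi_apply _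
    have h2 := h.comp hm1 hm2
    have e : Function.extend F (d j) 0 ∘ F = d j := by
      funext ω
      exact hfac.extend_apply 0 ω
    change IndepFun (Function.extend F (d j) 0 ∘ F) (U k) P at h2
    rwa [e] at h2
  have hmeasR : ∀ k, Measurable (fun ω => (d k ω : ℝ)) := fun k =>
    measurable_from_top.comp (hdmeas k)
  have hint : ∀ k, 1 ≤ k → k ≤ n → Integrable (fun ω => (d k ω : ℝ)) P := by
    intro k h1 h2
    refine Integrable.of_bound (hmeasR k).aestronglyMeasurable (k : ℝ) (ae_of_all _ fun ω => ?_)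
    simpa using hbd k h1 h2 ω
  have hprod : ∀ j k, 1 ≤ j → j < k → k ≤ n →
      Integrable (fun ω => (d j ω : ℝ) * (if U k ω = j then 1 else 0)) P ∧
      ∫ ω, (d j ω : ℝ) * (if U k ω = j then 1 else 0) ∂P
        = (∫ ω, (d j ω : ℝ) ∂P) * ((k : ℝ) - 1)⁻¹ := by
    intro j k hj hjk hk
    have hset : MeasurableSet {ω | U k ω = j} := hUmeas k (measurableSet_singleton j)
    have hIm : Measurable (fun ω => if U k ω = j then (1 : ℝ) else 0) :=
      Measurable.ite hset measurable_const measurable_const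
    have hi : IndepFun (fun ω => (d j ω : ℝ)) (fun ω => if U k ω = j then (1 : ℝ) else 0) P :=
      (hind j k hj hjk hk).comp (φ := fun m : ℕ => (m : ℝ))
        (ψ := fun m => if m = j then (1 : ℝ) else 0)
        measurable_from_top measurable_from_top
    have hIi : Integrable (fun ω => if U k ω = j then (1 : ℝ) else 0) P := by
      refine Integrable.of_bound hIm.aestronglyMeasurable 1 (ae_of_all _ fun ω => ?_)
      split_ifs <;> simp
    refine ⟨hi.integrable_mul (hint j hj (by omega)) hIi, ?_⟩
    rw [hi.integral_fun_mul_eq_mul_integral (hmeasR j).aestronglyMeasurable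
      hIm.aestronglyMeasurable]
    congr 1
    have : (fun ω => if U k ω = j then (1 : ℝ) else 0)
        = Set.indicator {ω | U k ω = j} 1 := by
      funext ω
      simp [Set.indicator]
    rw [this, integral_indicator_one hset, measureReal_def,
      hUunif k (by omega) hk j (Finset.mem_Icc.2 ⟨hj, by omega⟩)]
    rw [ENNReal.toReal_inv, ENNReal.toReal_natCast, Nat.cast_sub (by omega)]
    simp
  have hstep : ∀ k, 1 ≤ k → k + 1 ≤ n → ∫ ω, (d (k + 1) ω : ℝ) ∂P
      = (∑ j ∈ Finset.Icc 1 k, ∫ ω, (d j ω : ℝ) ∂P) * (k : ℝ)⁻¹ + 1 := by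
    intro k h1 h2
    have e : (fun ω => (d (k + 1) ω : ℝ)) = fun ω =>
        (∑ j ∈ Finset.Icc 1 k, (d j ω : ℝ) * (if U (k + 1) ω = j then 1 else 0)) + 1 := by
      funext ω
      have hr := hUrange (k + 1) (by omega) h2 ω
      simp only [Nat.add_sub_cancel] at hr
      rw [hdrec (k + 1) (by omega) h2]
      simp only [mul_ite, mul_one, mul_zero]
      rw [Finset.sum_ite_eq, if_pos hr]
      push_cast
      rfl
    have hp : ∀ j ∈ Finset.Icc 1 k, _ := fun j hj =>
      hprod j (k + 1) (Finset.mem_Icc.1 hj).1 (by have := (Finset.mem_Icc.1 hj).2; omega) h2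
    rw [e, integral_add (integrable_finsetSum _ fun j hj => (hp j hj).1) (integrable_const _),
      integral_finsetSum _ (fun j hj => (hp j hj).1), Finset.sum_congr rfl (fun j hj => (hp j hj).2),
      ← Finset.sum_mul]
    simp
  have hmain : ∀ m, 1 ≤ m → m ≤ n → ∑ j ∈ Finset.Icc 1 m, ∫ ω, (d j ω : ℝ) ∂P
      = (m : ℝ) * (∑ k ∈ Finset.Icc 1 m, (1 : ℝ) / (k : ℝ) - 1) := by
    intro m hm
    induction m, hm using Nat.le_induction with
    | base => intro _; simp [hd1]
    | succ k hk ih =>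
      intro hkn
      have ih := ih (by omega)
      rw [Finset.sum_Icc_succ_top (by omega), Finset.sum_Icc_succ_top (by omega),
        hstep k hk hkn, ih]
      have : (k : ℝ) ≠ 0 := by positivity
      have : (k : ℝ) + 1 ≠ 0 := by positivity
      push_cast
      field_simp
      ring
  rw [integral_finsetSum _ (fun j hj => hint j (Finset.mem_Icc.1 hj).1 (Finset.mem_Icc.1 hj).2)]
  exact hmain n hn le_rfl
end

section
/- There exists a positive constant C such that for every positive integer n, the total depth D_n of a random recursive tree on n vertices satisfies Var(D_n) ≤ C·n². -/
open MeasureTheory ProbabilityTheory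

lemma aux_step {Ω : Type*} [MeasurableSpace Ω] (P : Measure Ω) [IsProbabilityMeasure P]
    (m : ℕ) (V : Ω → ℕ) (hV : Measurable V) (hr : ∀ ω, V ω ∈ Finset.Icc 1 m)
    (hp : ∀ j ∈ Finset.Icc 1 m, P {ω | V ω = j} = (m : ENNReal)⁻¹)
    (G : ℕ → Ω → ℝ) (hG : ∀ j ∈ Finset.Icc 1 m, Measurable (G j))
    (hi : ∀ j ∈ Finset.Icc 1 m, Integrable (G j) P)
    (hind : ∀ j ∈ Finset.Icc 1 m, IndepFun V (G j) P) :
    ∫ ω, G (V ω) ω ∂P = ∫ ω, (m : ℝ)⁻¹ * ∑ j ∈ Finset.Icc 1 m, G j ω ∂P := by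
  have key : ∀ ω, G (V ω) ω = ∑ j ∈ Finset.Icc 1 m, (if V ω = j then (1:ℝ) else 0) * G j ω := by
    intro ω
    simp only [ite_mul, one_mul, zero_mul]
    rw [Finset.sum_ite_eq, if_pos (hr ω)]
  have hmI : ∀ j, Measurable (fun ω => if V ω = j then (1:ℝ) else 0) := fun j =>
    Measurable.ite (hV (measurableSet_singleton j)) measurable_const measurable_const
  simp_rw [key]
  rw [integral_finset_sum, integral_const_mul, integral_finset_sum _ hi, Finset.mul_sum]
  · refine Finset.sum_congr rfl fun j hj => ?_
    have h1 : IndepFun (fun ω => if V ω = j then (1:ℝ) else 0) (G j) P :=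
      (hind j hj).comp (φ := fun v : ℕ => if v = j then (1:ℝ) else 0) (ψ := id)
        (measurable_from_top) measurable_id
    have h2 := h1.integral_fun_mul_eq_mul_integral (hmI j).aestronglyMeasurable
      (hG j hj).aestronglyMeasurable
    rw [h2]
    congr 1
    have : (fun ω => if V ω = j then (1:ℝ) else 0) = Set.indicator {ω | V ω = j} 1 := by
      ext ω; simp [Set.indicator]
    have hs : MeasurableSet {ω | V ω = j} := hV (measurableSet_singleton j)
    rw [this]
    refine (integral_indicator_one hs).trans ?_
    rw [Measure.real, hp j hj]
    simp
  · intro j hj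
    refine (hi j hj).bdd_mul (c := 1) (hmI j).aestronglyMeasurable ?_
    refine Filter.Eventually.of_forall fun ω => ?_
    split_ifs <;> simp

/-- pointwise inequality -/
lemma aux_pt (m : ℕ) (hm : 1 ≤ m) (x : ℕ → ℝ) (c : ℝ) :
    (m : ℝ)⁻¹ * ∑ j ∈ Finset.Icc 1 m,
      ((∑ k ∈ Finset.Icc 1 m, x k + (x j + 1) - (c * (1 + (m:ℝ)⁻¹) + 1)) ^ 2
        + 2 * (∑ k ∈ Finset.Icc 1 m, x k ^ 2 + (x j + 1) ^ 2) + 6 * ((m:ℝ) + 1))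
    ≤ (1 + (m:ℝ)⁻¹) ^ 2 * ((∑ k ∈ Finset.Icc 1 m, x k - c) ^ 2
        + 2 * ∑ k ∈ Finset.Icc 1 m, x k ^ 2 + 6 * m) := by
  set D := ∑ k ∈ Finset.Icc 1 m, x k with hD
  set Q := ∑ k ∈ Finset.Icc 1 m, x k ^ 2 with hQ
  have hm' : (1:ℝ) ≤ m := by exact_mod_cast hm
  have hQ0 : 0 ≤ Q := Finset.sum_nonneg fun _ _ => sq_nonneg _
  set t := (m:ℝ)⁻¹ with ht
  have htm : t * m = 1 := inv_mul_cancel₀ (by positivity)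
  have ht0 : 0 < t := by positivity
  have hle : ∀ j ∈ Finset.Icc 1 m, ((D + (x j + 1) - (c * (1 + t) + 1)) ^ 2
        + 2 * (Q + (x j + 1) ^ 2) + 6 * ((m:ℝ) + 1)) ≤
      4 * x j ^ 2 + (2 * (D - c - c * t)) * x j + ((D - c - c * t)^2 + 2 * Q + 6 + 6 * (m + 1)) := by
    intro j _
    nlinarith [sq_nonneg (x j - 2)]
  refine (mul_le_mul_of_nonneg_left (Finset.sum_le_sum hle) ht0.le).trans ?_
  rw [Finset.sum_add_distrib, Finset.sum_add_distrib, ← Finset.mul_sum, ← Finset.mul_sum, ← hD, ← hQ]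
  simp only [Finset.sum_const, Nat.card_Icc, nsmul_eq_mul, add_tsub_cancel_right]
  have e1 : t * (4 * Q + 2 * (D - c - c * t) * D + m * ((D - c - c * t)^2 + 2 * Q + 6 + 6 * (m + 1)))
    = t * 4 * Q + t * (2 * (D - c - c * t) * D) + (D - c - c * t)^2 + 2 * Q + 6 + 6 * (m + 1) := by
    linear_combination ((D - c - c * t)^2 + 2 * Q + 6 + 6 * (m + 1)) * htm
  rw [e1]
  have e2 : (1 + t)^2 * (6 * (m:ℝ)) = 6 * m + 12 + 6 * t := by
    linear_combination (12 + 6 * t) * htm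
  have : 0 ≤ t^2 * Q := by positivity
  nlinarith [sq_nonneg (t * D)]

lemma aux_bdd {Ω : Type*} (n : ℕ) (U : ℕ → Ω → ℕ) (d : ℕ → Ω → ℕ)
    (hr : ∀ k, 2 ≤ k → k ≤ n → ∀ ω, U k ω ∈ Finset.Icc 1 (k - 1))
    (h1 : ∀ ω, d 1 ω = 0)
    (hd : ∀ k, 2 ≤ k → k ≤ n → ∀ ω, d k ω = d (U k ω) ω + 1) (ω : Ω) :
    ∀ k, 1 ≤ k → k ≤ n → d k ω ≤ k := by
  intro k
  induction k using Nat.strong_induction_on with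
  | _ k ih =>
    intro hk hkn
    rcases Nat.lt_or_ge k 2 with h | h
    · obtain rfl : k = 1 := by omega
      simp [h1]
    · have hu := Finset.mem_Icc.1 (hr k h hkn ω)
      have := ih (U k ω) (by omega) hu.1 (by omega)
      rw [hd k h hkn]; omega

lemma aux_fac {Ω : Type*} (n m : ℕ) (hmn : m ≤ n) (U : ℕ → Ω → ℕ) (d : ℕ → Ω → ℕ)
    (hr : ∀ k, 2 ≤ k → k ≤ n → ∀ ω, U k ω ∈ Finset.Icc 1 (k - 1))
    (h1 : ∀ ω, d 1 ω = 0)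
    (hd : ∀ k, 2 ≤ k → k ≤ n → ∀ ω, d k ω = d (U k ω) ω + 1) (ω ω' : Ω)
    (he : ∀ k, 2 ≤ k → k ≤ m → U k ω = U k ω') :
    ∀ k, 1 ≤ k → k ≤ m → d k ω = d k ω' := by
  intro k
  induction k using Nat.strong_induction_on with
  | _ k ih =>
    intro hk hkn
    rcases Nat.lt_or_ge k 2 with h | h
    · obtain rfl : k = 1 := by omega
      simp [h1]
    · have hu := Finset.mem_Icc.1 (hr k h (by omega) ω)
      have := ih (U k ω) (by omega) hu.1 (by omega)
      rw [hd k h (by omega), hd k h (by omega), this, he k h hkn]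

lemma aux_ind {Ω : Type*} [MeasurableSpace Ω] (P : Measure Ω) [IsProbabilityMeasure P]
    (n m : ℕ) (hm : 1 ≤ m) (hmn : m + 1 ≤ n) (U : ℕ → Ω → ℕ) (hU : ∀ k, Measurable (U k))
    (hI : iIndepFun (fun k : {k : ℕ // 2 ≤ k ∧ k ≤ n} => U k.1) P)
    (g : Ω → ℝ) (hg : ∀ ω ω', (∀ k, 2 ≤ k → k ≤ m → U k ω = U k ω') → g ω = g ω') :
    IndepFun (U (m + 1)) g P := by
  classical
  haveI : Fintype {k : ℕ // 2 ≤ k ∧ k ≤ n} :=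
    Fintype.ofFinset (Finset.Icc 2 n) (fun x => by simp; rfl)
  let S : Finset {k : ℕ // 2 ≤ k ∧ k ≤ n} := {⟨m + 1, by omega, hmn⟩}
  let T : Finset {k : ℕ // 2 ≤ k ∧ k ≤ n} := Finset.univ.filter fun k => k.1 ≤ m
  have hST : Disjoint S T := by
    simp [S, T]
  have h := hI.indepFun_finset S T hST (fun i => hU i.1)
  let past : Ω → (T → ℕ) := fun ω i => U i.1.1 ω
  have hf : Function.FactorsThrough g past := by
    intro ω ω' hp
    refine hg ω ω' fun k hk hkm => ?_
    exact congrFun hp ⟨⟨k, hk, by omega⟩, by simp [T, hkm]⟩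
  have h2 := IndepFun.comp (_mγ := (inferInstance : MeasurableSpace ℕ)) (_mγ' := (inferInstance : MeasurableSpace ℝ)) h (φ := fun v : S → ℕ => v ⟨⟨m + 1, by omega, hmn⟩, by simp [S]⟩)
    (ψ := Function.extend past g (fun _ => 0)) (measurable_of_countable _ : Measurable _) (measurable_of_countable _ : Measurable _)
  have e : Function.extend past g (fun _ => 0) ∘ past = g := by
    ext ω; exact hf.extend_apply _ _
  change IndepFun (U (m + 1)) (Function.extend past g (fun _ => 0) ∘ past) P at h2
  rwa [e] at h2

/-- centering constants -/
noncomputable def cc : ℕ → ℝ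
  | 0 => 0
  | (m + 1) => if m = 0 then 0 else cc m * (1 + (m:ℝ)⁻¹) + 1


/-- There is a positive constant `C` such that for every `n ≥ 1`, the total depth `D_n`
of a random recursive tree on `n` vertices satisfies `Var(D_n) ≤ C·n²`. -/
theorem stmt8 : ∃ C : ℝ, 0 < C ∧ ∀ (n : ℕ), 1 ≤ n →
    ∀ (Ω : Type*) [MeasurableSpace Ω] (P : Measure Ω) [IsProbabilityMeasure P]
      (U : ℕ → Ω → ℕ), (∀ k, Measurable (U k)) →
    (∀ k, 2 ≤ k → k ≤ n → ∀ ω, U k ω ∈ Finset.Icc 1 (k - 1)) →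
    (∀ k, 2 ≤ k → k ≤ n → ∀ j ∈ Finset.Icc 1 (k - 1),
      P {ω | U k ω = j} = ((k - 1 : ℕ) : ENNReal)⁻¹) →
    iIndepFun
      (fun k : {k : ℕ // 2 ≤ k ∧ k ≤ n} => U k.1) P →
    ∀ (d : ℕ → Ω → ℕ), (∀ k, Measurable (d k)) →
    (∀ ω, d 1 ω = 0) →
    (∀ k, 2 ≤ k → k ≤ n → ∀ ω, d k ω = d (U k ω) ω + 1) →
    variance (fun ω => ∑ k ∈ Finset.Icc 1 n, (d k ω : ℝ)) P ≤ C * (n : ℝ) ^ 2 := by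
  refine ⟨6, by norm_num, ?_⟩
  intro n hn Ω _ P _ U hU hr hp hI d hdm h1 hd
  have hb := aux_bdd n U d hr h1 hd
  have hmD : ∀ m, Measurable (fun ω => ∑ k ∈ Finset.Icc 1 m, (d k ω : ℝ)) := fun m =>
    Finset.measurable_sum _ fun k _ => measurable_from_top.comp (hdm k)
  have hmQ : ∀ m, Measurable (fun ω => ∑ k ∈ Finset.Icc 1 m, (d k ω : ℝ) ^ 2) := fun m =>
    Finset.measurable_sum _ fun k _ => (measurable_from_top.comp (hdm k)).pow_const 2
  have md : ∀ j, j ∈ Finset.Icc 1 n → MemLp (fun ω => (d j ω : ℝ)) ⊤ P := fun j hj => by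
    refine memLp_top_of_bound (measurable_from_top.comp (hdm j)).aestronglyMeasurable (j:ℝ)
      (Filter.Eventually.of_forall fun ω => ?_)
    have := Finset.mem_Icc.1 hj
    simpa using hb ω j this.1 this.2
  have mD : ∀ m, m ≤ n → MemLp (fun ω => ∑ k ∈ Finset.Icc 1 m, (d k ω : ℝ)) ⊤ P := fun m hm =>
    memLp_finset_sum _ fun j hj => md j (Finset.Icc_subset_Icc_right hm hj)
  have sq : ∀ f : Ω → ℝ, MemLp f ⊤ P → Integrable (fun ω => f ω ^ 2) P := fun f hf =>
    (hf.mono_exponent le_top).integrable_sq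
  have iQ : ∀ m, m ≤ n → Integrable (fun ω => ∑ k ∈ Finset.Icc 1 m, (d k ω : ℝ) ^ 2) P := fun m hm =>
    integrable_finset_sum _ fun j hj => sq _ (md j (Finset.Icc_subset_Icc_right hm hj))
  have iF : ∀ m, m ≤ n → Integrable (fun ω => (∑ k ∈ Finset.Icc 1 m, (d k ω : ℝ) - cc m) ^ 2
        + 2 * ∑ k ∈ Finset.Icc 1 m, (d k ω : ℝ) ^ 2 + 6 * (m:ℝ)) P := fun m hm =>
    ((sq _ ((mD m hm).sub (memLp_const _))).add ((iQ m hm).const_mul 2)).add (integrable_const _)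
  have main : ∀ m, 1 ≤ m → m ≤ n →
      ∫ ω, ((∑ k ∈ Finset.Icc 1 m, (d k ω : ℝ) - cc m) ^ 2
        + 2 * ∑ k ∈ Finset.Icc 1 m, (d k ω : ℝ) ^ 2 + 6 * (m:ℝ)) ∂P ≤ 6 * (m:ℝ) ^ 2 := by
    intro m hm
    induction m, hm using Nat.le_induction with
    | base => intro _; simp [h1, cc]
    | succ m hm ih =>
      intro hmn
      have ih := ih (by omega)
      let G : ℕ → Ω → ℝ := fun j ω =>
        (∑ k ∈ Finset.Icc 1 m, (d k ω : ℝ) + ((d j ω : ℝ) + 1) - (cc m * (1 + (m:ℝ)⁻¹) + 1)) ^ 2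
        + 2 * (∑ k ∈ Finset.Icc 1 m, (d k ω : ℝ) ^ 2 + ((d j ω : ℝ) + 1) ^ 2) + 6 * ((m:ℝ) + 1)
      have hsub : ∀ j ∈ Finset.Icc 1 m, j ∈ Finset.Icc 1 n := fun j hj =>
        Finset.Icc_subset_Icc_right (by omega) hj
      have hGm : ∀ j, Measurable (G j) := fun j => by
        have h3 : Measurable (fun ω => (d j ω : ℝ)) := measurable_from_top.comp (hdm j)
        have := hmD m
        have := hmQ m
        fun_prop
      have hGi : ∀ j ∈ Finset.Icc 1 m, Integrable (G j) P := fun j hj => by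
        have h3 := (md j (hsub j hj)).add (memLp_const (1:ℝ))
        exact ((sq _ (((mD m (by omega)).add h3).sub (memLp_const _))).add
          (((iQ m (by omega)).add (sq _ h3)).const_mul 2)).add (integrable_const _)
      have hGind : ∀ j ∈ Finset.Icc 1 m, IndepFun (U (m + 1)) (G j) P := fun j hj => by
        refine aux_ind P n m hm hmn U hU hI (G j) fun ω ω' he => ?_
        have hf := aux_fac n m (by omega) U d hr h1 hd ω ω' he
        have hs : ∀ k ∈ Finset.Icc 1 m, d k ω = d k ω' := fun k hk =>
          hf k (Finset.mem_Icc.1 hk).1 (Finset.mem_Icc.1 hk).2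
        simp only [G]
        rw [Finset.sum_congr rfl (fun k hk => by rw [hs k hk]),
          Finset.sum_congr (f := fun k => (d k ω : ℝ) ^ 2) rfl (fun k hk => by rw [hs k hk]), hs j hj]
      have st := aux_step P m (U (m + 1)) (hU _) (fun ω => by simpa using hr (m + 1) (by omega) hmn ω)
        (fun j hj => by simpa using hp (m + 1) (by omega) hmn j (by simpa using hj)) G
        (fun j _ => hGm j) hGi hGind
      have e : ∀ ω, (∑ k ∈ Finset.Icc 1 (m + 1), (d k ω : ℝ) - cc (m + 1)) ^ 2
        + 2 * ∑ k ∈ Finset.Icc 1 (m + 1), (d k ω : ℝ) ^ 2 + 6 * ((m + 1 : ℕ):ℝ) = G (U (m + 1) ω) ω := by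
        intro ω
        have hm0 : m ≠ 0 := by omega
        rw [Finset.sum_Icc_succ_top (by omega), Finset.sum_Icc_succ_top (by omega),
          hd (m + 1) (by omega) hmn ω]
        simp [G, cc, hm0]
      simp_rw [e]
      rw [st]
      calc _ ≤ ∫ ω, (1 + (m:ℝ)⁻¹) ^ 2 * ((∑ k ∈ Finset.Icc 1 m, (d k ω : ℝ) - cc m) ^ 2
            + 2 * ∑ k ∈ Finset.Icc 1 m, (d k ω : ℝ) ^ 2 + 6 * (m:ℝ)) ∂P :=
            integral_mono ((integrable_finset_sum _ hGi).const_mul _) ((iF m (by omega)).const_mul _)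
              (fun ω => aux_pt m hm (fun k => (d k ω : ℝ)) (cc m))
        _ ≤ (1 + (m:ℝ)⁻¹) ^ 2 * (6 * (m:ℝ) ^ 2) := by
            rw [integral_const_mul]
            exact mul_le_mul_of_nonneg_left ih (by positivity)
        _ = _ := by
            have : (m:ℝ) ≠ 0 := by positivity
            push_cast
            field_simp
  have hv : variance (fun ω => ∑ k ∈ Finset.Icc 1 n, (d k ω : ℝ)) P
      = variance (fun ω => ∑ k ∈ Finset.Icc 1 n, (d k ω : ℝ) - cc n) P :=
    (variance_sub_const (hmD n).aestronglyMeasurable _).symm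
  rw [hv]
  refine (variance_le_expectation_sq ((hmD n).sub_const _).aestronglyMeasurable).trans ?_
  refine le_trans ?_ (main n hn le_rfl)
  refine integral_mono (sq _ ((mD n le_rfl).sub (memLp_const _))) (iF n le_rfl) fun ω => ?_
  have : 0 ≤ ∑ k ∈ Finset.Icc 1 n, (d k ω : ℝ) ^ 2 := Finset.sum_nonneg fun _ _ => sq_nonneg _
  have : (0:ℝ) ≤ n := by positivity
  simp only [Pi.pow_apply]
  linarith
end

section
/- For every positive integer n, the total depth of a random recursive tree on n vertices satisfies Var(D_n) ≤ n² · ∑_{k=1}^{n} E[d_k²]/k². -/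
open MeasureTheory ProbabilityTheory

def Bd9 {Ω : Type*} [MeasurableSpace Ω] (f : Ω → ℝ) : Prop :=
  Measurable f ∧ ∃ C : ℝ, ∀ ω, |f ω| ≤ C

lemma Bd9.int {Ω : Type*} [MeasurableSpace Ω] {P : Measure Ω} [IsProbabilityMeasure P]
    {f : Ω → ℝ} (h : Bd9 f) : Integrable f P := by
  obtain ⟨hm, C, hC⟩ := h
  exact Integrable.of_bound hm.aestronglyMeasurable C (Filter.Eventually.of_forall hC)

lemma Bd9.memLp {Ω : Type*} [MeasurableSpace Ω] {P : Measure Ω} [IsProbabilityMeasure P]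
    {f : Ω → ℝ} (h : Bd9 f) : MemLp f 2 P := by
  obtain ⟨hm, C, hC⟩ := h
  exact MemLp.of_bound hm.aestronglyMeasurable C (Filter.Eventually.of_forall hC)

lemma Bd9.mul {Ω : Type*} [MeasurableSpace Ω] {f g : Ω → ℝ} (hf : Bd9 f) (hg : Bd9 g) :
    Bd9 (fun ω => f ω * g ω) := by
  obtain ⟨hm, C, hC⟩ := hf
  obtain ⟨hm', C', hC'⟩ := hg
  refine ⟨hm.mul hm', C * C', fun ω => ?_⟩
  rw [abs_mul]
  exact mul_le_mul (hC ω) (hC' ω) (abs_nonneg _) ((abs_nonneg _).trans (hC ω))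

lemma Bd9.add {Ω : Type*} [MeasurableSpace Ω] {f g : Ω → ℝ} (hf : Bd9 f) (hg : Bd9 g) :
    Bd9 (fun ω => f ω + g ω) := by
  obtain ⟨hm, C, hC⟩ := hf
  obtain ⟨hm', C', hC'⟩ := hg
  exact ⟨hm.add hm', C + C', fun ω => (abs_add_le _ _).trans (add_le_add (hC ω) (hC' ω))⟩

lemma Bd9.const {Ω : Type*} [MeasurableSpace Ω] (c : ℝ) : Bd9 (fun _ : Ω => c) :=
  ⟨measurable_const, |c|, fun _ => le_rfl⟩

lemma Bd9.sum {Ω : Type*} [MeasurableSpace Ω] {f : ℕ → Ω → ℝ} (s : Finset ℕ)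
    (hf : ∀ i ∈ s, Bd9 (f i)) : Bd9 (fun ω => ∑ i ∈ s, f i ω) := by
  induction s using Finset.induction_on with
  | empty => simpa using Bd9.const (Ω := Ω) 0
  | insert a s ha ih =>
    simp only [Finset.sum_insert ha]
    exact (hf a (by simp)).add (ih fun i hi => hf i (by simp [hi]))

lemma indep9 (n : ℕ)
    {Ω : Type*} [MeasurableSpace Ω] (P : Measure Ω) [IsProbabilityMeasure P]
    (U : ℕ → Ω → ℕ) (hUmeas : ∀ k, Measurable (U k))
    (hUindep : iIndepFun
      (fun k : {k : ℕ // 2 ≤ k ∧ k ≤ n} => U k.1) P)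
    (k : ℕ) (hk : 2 ≤ k) (hkn : k ≤ n) (W : Ω → ℝ)
    (hW : ∀ ω ω', (∀ i, 2 ≤ i → i < k → U i ω = U i ω') → W ω = W ω') :
    IndepFun W (U k) P := by
  classical
  haveI : Fintype {k : ℕ // 2 ≤ k ∧ k ≤ n} :=
    Fintype.ofInjective (fun x => (⟨x.1, by omega⟩ : Fin (n+1))) (by
      intro a b h
      simpa [Subtype.ext_iff] using h)
  let S : Finset {k : ℕ // 2 ≤ k ∧ k ≤ n} := Finset.univ.filter (fun i => i.1 < k)
  let T : Finset {k : ℕ // 2 ≤ k ∧ k ≤ n} := {⟨k, hk, hkn⟩}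
  have hST : Disjoint S T := by
    rw [Finset.disjoint_left]
    intro a ha hb
    simp only [S, T, Finset.mem_filter, Finset.mem_singleton] at ha hb
    subst hb
    simp at ha
  have h := hUindep.indepFun_finset S T hST (fun i => hUmeas i.1)
  have hF : Function.FactorsThrough W (fun ω (i : S) => U i.1.1 ω) := by
    intro ω ω' h
    apply hW
    intro i h2 hi
    exact congrFun h ⟨⟨i, h2, by omega⟩, by simp [S, hi]⟩
  have hWe : W = (Function.extend (fun ω (i : S) => U i.1.1 ω) W 0) ∘
      (fun ω (i : S) => U i.1.1 ω) := by
    funext ω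
    exact (hF.extend_apply 0 ω).symm
  rw [hWe]
  exact h.comp (φ := Function.extend (fun ω (i : S) => U i.1.1 ω) W 0)
    (ψ := fun f : T → ℕ => f ⟨⟨k, hk, hkn⟩, by simp [T]⟩)
    (measurable_of_countable _) (measurable_of_countable _)

lemma key9 (n : ℕ)
    {Ω : Type*} [MeasurableSpace Ω] (P : Measure Ω) [IsProbabilityMeasure P]
    (U : ℕ → Ω → ℕ) (hUmeas : ∀ k, Measurable (U k))
    (hUrange : ∀ k, 2 ≤ k → k ≤ n → ∀ ω, U k ω ∈ Finset.Icc 1 (k - 1))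
    (hUunif : ∀ k, 2 ≤ k → k ≤ n → ∀ j ∈ Finset.Icc 1 (k - 1),
      P {ω | U k ω = j} = ((k - 1 : ℕ) : ENNReal)⁻¹)
    (hUindep : iIndepFun
      (fun k : {k : ℕ // 2 ≤ k ∧ k ≤ n} => U k.1) P)
    (d : ℕ → Ω → ℕ)
    (hB : ∀ j, 1 ≤ j → j ≤ n → Bd9 (fun ω => (d j ω : ℝ)))
    (hd1 : ∀ ω, d 1 ω = 0)
    (hdrec : ∀ k, 2 ≤ k → k ≤ n → ∀ ω, d k ω = d (U k ω) ω + 1)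
    (hfac : ∀ j, 1 ≤ j → j ≤ n → ∀ ω ω', (∀ i, 2 ≤ i → i ≤ j → U i ω = U i ω') → d j ω = d j ω')
    (m : ℕ) (hm : 1 ≤ m) (hmn : m + 1 ≤ n) (W : Ω → ℝ) (hWB : Bd9 W)
    (hW : ∀ ω ω', (∀ i, 2 ≤ i → i < m + 1 → U i ω = U i ω') → W ω = W ω') :
    ∫ ω, W ω * (d (m+1) ω : ℝ) ∂P =
      ∫ ω, W ω * ((∑ j ∈ Finset.Icc 1 m, (d j ω : ℝ)) * (m : ℝ)⁻¹ + 1) ∂P := by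
  have hI : ∀ j, Bd9 (fun ω => if U (m+1) ω = j then (1:ℝ) else 0) := by
    intro j
    refine ⟨Measurable.ite ((hUmeas _) (measurableSet_singleton j)) measurable_const
      measurable_const, 1, fun ω => ?_⟩
    show |if U (m+1) ω = j then (1:ℝ) else 0| ≤ 1
    split_ifs <;> simp
  have hWd : ∀ j ∈ Finset.Icc 1 m, Bd9 (fun ω => W ω * (d j ω : ℝ)) := by
    intro j hj
    rw [Finset.mem_Icc] at hj
    exact hWB.mul (hB j hj.1 (by omega))
  have e1 : ∀ ω, W ω * (d (m+1) ω : ℝ) =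
      (∑ j ∈ Finset.Icc 1 m, (W ω * (d j ω : ℝ)) * (if U (m+1) ω = j then (1:ℝ) else 0)) + W ω := by
    intro ω
    have hr := hUrange (m+1) (by omega) hmn ω
    simp only [Nat.add_sub_cancel] at hr
    rw [hdrec (m+1) (by omega) hmn ω]
    simp only [mul_ite, mul_one, mul_zero]
    rw [Finset.sum_ite_eq, if_pos hr]
    push_cast; ring
  have e2 : ∀ ω, W ω * ((∑ j ∈ Finset.Icc 1 m, (d j ω : ℝ)) * (m : ℝ)⁻¹ + 1) =
      (∑ j ∈ Finset.Icc 1 m, (W ω * (d j ω : ℝ)) * (m:ℝ)⁻¹) + W ω := by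
    intro ω
    rw [← Finset.sum_mul, ← Finset.mul_sum]; ring
  simp only [e1, e2]
  rw [integral_add (Bd9.sum _ fun j hj => (hWd j hj).mul (hI j)).int hWB.int,
    integral_add (Bd9.sum _ fun j hj => (hWd j hj).mul (Bd9.const _)).int hWB.int,
    integral_finsetSum _ (fun j hj => ((hWd j hj).mul (hI j)).int),
    integral_finsetSum _ (fun j hj => ((hWd j hj).mul (Bd9.const _)).int)]
  congr 1
  refine Finset.sum_congr rfl fun j hj => ?_
  have hj' := Finset.mem_Icc.1 hj
  have hind := indep9 n P U hUmeas hUindep (m+1) (by omega) hmn (fun ω => W ω * (d j ω : ℝ)) (by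
    intro ω ω' h
    rw [hW ω ω' h, hfac j hj'.1 (by omega) ω ω' (fun i h2 hi => h i h2 (by omega))])
  have hind2 := hind.comp (φ := id) (ψ := fun x : ℕ => if x = j then (1:ℝ) else 0)
    measurable_id (measurable_of_countable _)
  have := hind2.integral_mul_eq_mul_integral (hWd j hj).1.aestronglyMeasurable
    (hI j).1.aestronglyMeasurable
  have h3 : ∫ ω, (if U (m+1) ω = j then (1:ℝ) else 0) ∂P = (m:ℝ)⁻¹ := by
    have hu := hUunif (m+1) (by omega) hmn j (by simpa using hj)
    have hs : MeasurableSet {ω | U (m+1) ω = j} := (hUmeas _) (measurableSet_singleton j)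
    have : (fun ω => if U (m+1) ω = j then (1:ℝ) else 0) =
        Set.indicator {ω | U (m+1) ω = j} 1 := by
      funext ω; simp [Set.indicator_apply]
    rw [this, integral_indicator_one hs, Measure.real, hu]
    simp
  rw [integral_mul_const, ← h3]
  exact this

lemma final9 {Ω : Type*} [MeasurableSpace Ω] (P : Measure Ω) [IsProbabilityMeasure P]
    (S X : Ω → ℝ) (hS : Bd9 S) (hX : Bd9 X) (c : ℝ)
    (k1 : ∫ ω, X ω ∂P = ∫ ω, (S ω * c + 1) ∂P)
    (k2 : ∫ ω, S ω * X ω ∂P = ∫ ω, S ω * (S ω * c + 1) ∂P) :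
    variance (fun ω => S ω + X ω) P ≤ (1 + c) ^ 2 * variance S P + ∫ ω, X ω ^ 2 ∂P := by
  have v0 := variance_nonneg S P
  have v1 := variance_eq_sub (hS.memLp (P := P))
  have v2 := variance_eq_sub ((hS.add hX).memLp (P := P))
  have e1 : ∫ ω, (S ω * c + 1) ∂P = (∫ ω, S ω ∂P) * c + 1 := by
    rw [integral_add (hS.mul (Bd9.const c)).int (Bd9.const 1).int, integral_mul_const]
    simp
  have e2 : ∫ ω, S ω * (S ω * c + 1) ∂P = (∫ ω, S ω * S ω ∂P) * c + ∫ ω, S ω ∂P := by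
    rw [← integral_mul_const, ← integral_add ((hS.mul hS).mul (Bd9.const c)).int hS.int]
    congr 1; funext ω; ring
  have e3 : ∫ ω, (S ω + X ω) ∂P = ∫ ω, S ω ∂P + ∫ ω, X ω ∂P := integral_add hS.int hX.int
  have e4 : ∫ ω, (S ω + X ω) ^ 2 ∂P =
      ∫ ω, S ω * S ω ∂P + (∫ ω, S ω * X ω ∂P) * 2 + ∫ ω, X ω ^ 2 ∂P := by
    have e : ∀ ω, (S ω + X ω) ^ 2 = (S ω * S ω + S ω * X ω * 2) + X ω * X ω := fun ω => by ring
    simp only [e, pow_two (X _)]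
    rw [integral_add ((hS.mul hS).add ((hS.mul hX).mul (Bd9.const 2))).int (hX.mul hX).int,
      integral_add (hS.mul hS).int ((hS.mul hX).mul (Bd9.const 2)).int, integral_mul_const]
  simp only [Pi.pow_apply] at v1 v2
  have e5 : ∫ ω, S ω ^ 2 ∂P = ∫ ω, S ω * S ω ∂P := by simp only [pow_two]
  rw [e3, e4, k1, k2, e1, e2] at v2
  rw [e5] at v1
  rw [v2, v1]
  rw [v1] at v0
  nlinarith [mul_nonneg (sq_nonneg c) v0, sq_nonneg (c * (∫ ω, S ω ∂P) + 1)]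

/-- For a random recursive tree on `n` vertices,
`Var(D_n) ≤ n² · ∑_{k=1}^{n} E[d_k²]/k²`. -/
theorem stmt9 (n : ℕ) (hn : 1 ≤ n)
    (Ω : Type*) [MeasurableSpace Ω] (P : Measure Ω) [IsProbabilityMeasure P]
    (U : ℕ → Ω → ℕ) (hUmeas : ∀ k, Measurable (U k))
    (hUrange : ∀ k, 2 ≤ k → k ≤ n → ∀ ω, U k ω ∈ Finset.Icc 1 (k - 1))
    (hUunif : ∀ k, 2 ≤ k → k ≤ n → ∀ j ∈ Finset.Icc 1 (k - 1),
      P {ω | U k ω = j} = ((k - 1 : ℕ) : ENNReal)⁻¹)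
    (hUindep : iIndepFun
      (fun k : {k : ℕ // 2 ≤ k ∧ k ≤ n} => U k.1) P)
    (d : ℕ → Ω → ℕ) (hdmeas : ∀ k, Measurable (d k))
    (hd1 : ∀ ω, d 1 ω = 0)
    (hdrec : ∀ k, 2 ≤ k → k ≤ n → ∀ ω, d k ω = d (U k ω) ω + 1) :
    variance (fun ω => ∑ k ∈ Finset.Icc 1 n, (d k ω : ℝ)) P
      ≤ (n : ℝ) ^ 2 * ∑ k ∈ Finset.Icc 1 n, (∫ ω, (d k ω : ℝ) ^ 2 ∂P) / (k : ℝ) ^ 2 := by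
  have hbound : ∀ j, 1 ≤ j → j ≤ n → ∀ ω, d j ω ≤ j := by
    intro j
    induction j using Nat.strong_induction_on with
    | _ j ih =>
      intro h1 hjn ω
      by_cases h : j = 1
      · subst h; simp [hd1]
      · have hr := Finset.mem_Icc.1 (hUrange j (by omega) hjn ω)
        rw [hdrec j (by omega) hjn ω]
        have := ih (U j ω) (by omega) hr.1 (by omega) ω
        omega
  have hfac : ∀ j, 1 ≤ j → j ≤ n → ∀ ω ω',
      (∀ i, 2 ≤ i → i ≤ j → U i ω = U i ω') → d j ω = d j ω' := by
    intro j
    induction j using Nat.strong_induction_on with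
    | _ j ih =>
      intro h1 hjn ω ω' hU
      by_cases h : j = 1
      · subst h; simp [hd1]
      · have hr := Finset.mem_Icc.1 (hUrange j (by omega) hjn ω)
        rw [hdrec j (by omega) hjn ω, hdrec j (by omega) hjn ω', ← hU j (by omega) le_rfl]
        rw [ih (U j ω) (by omega) hr.1 (by omega) ω ω' (fun i h2 hi => hU i h2 (by omega))]
  have hB : ∀ j, 1 ≤ j → j ≤ n → Bd9 (fun ω => (d j ω : ℝ)) := by
    intro j h1 hj
    refine ⟨(measurable_of_countable (fun x : ℕ => (x:ℝ))).comp (hdmeas j), j, fun ω => ?_⟩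
    show |(d j ω : ℝ)| ≤ j
    rw [abs_of_nonneg (by positivity)]
    exact_mod_cast hbound j h1 hj ω
  have main : ∀ m, 1 ≤ m → m ≤ n →
      variance (fun ω => ∑ k ∈ Finset.Icc 1 m, (d k ω : ℝ)) P
      ≤ (m : ℝ) ^ 2 * ∑ k ∈ Finset.Icc 1 m, (∫ ω, (d k ω : ℝ) ^ 2 ∂P) / (k : ℝ) ^ 2 := by
    intro m hm
    induction m, hm using Nat.le_induction with
    | base =>
      intro _
      have h0 : variance (fun _ : Ω => (0:ℝ)) P = 0 := variance_zero P
      simp [hd1, h0]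
    | succ m hm ih =>
      intro hmn
      specialize ih (by omega)
      have hS : Bd9 (fun ω => ∑ k ∈ Finset.Icc 1 m, (d k ω : ℝ)) :=
        Bd9.sum _ fun j hj => hB j (Finset.mem_Icc.1 hj).1 (by have := (Finset.mem_Icc.1 hj).2; omega)
      have hX := hB (m+1) (by omega) hmn
      have k1 := key9 n P U hUmeas hUrange hUunif hUindep d hB hd1 hdrec hfac m hm hmn
        (fun _ => 1) (Bd9.const 1) (fun _ _ _ => rfl)
      have k2 := key9 n P U hUmeas hUrange hUunif hUindep d hB hd1 hdrec hfac m hm hmn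
        (fun ω => ∑ k ∈ Finset.Icc 1 m, (d k ω : ℝ)) hS (by
          intro ω ω' h
          refine Finset.sum_congr rfl fun j hj => ?_
          have hj := Finset.mem_Icc.1 hj
          rw [hfac j hj.1 (by omega) ω ω' (fun i h2 hi => h i h2 (by omega))])
      simp only [Finset.sum_Icc_succ_top (show 1 ≤ m + 1 by omega)]
      generalize hSd : (fun ω => ∑ k ∈ Finset.Icc 1 m, (d k ω : ℝ)) = S at *
      have hSd' : ∀ ω, ∑ k ∈ Finset.Icc 1 m, (d k ω : ℝ) = S ω := fun ω => congrFun hSd ω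
      simp only [hSd', one_mul] at k1 k2 ⊢
      have hv := final9 P S (fun ω => (d (m+1) ω : ℝ)) hS hX (m:ℝ)⁻¹ k1 k2
      have hm0 : (0:ℝ) < m := by exact_mod_cast hm
      refine hv.trans ?_
      have h2 := mul_le_mul_of_nonneg_left ih (sq_nonneg (1 + (m:ℝ)⁻¹))
      refine (add_le_add_left h2 _).trans (le_of_eq ?_)
      push_cast
      field_simp
  exact main n hn le_rfl
end

section
/- In a random recursive tree on n vertices, for every k with 2 ≤ k ≤ n and every integer j ≥ 1, P(d_k = j) = (1/(k−1)) · ∑ 1/((i_1 − 1)⋯(i_{j−1} − 1)), where the sum ranges over all integer sequences 1 < i_1 < i_2 < ⋯ < i_{j−1} < k (for j = 1 the empty sum of products is interpreted as 1, giving P(d_k = 1) = 1/(k−1)). -/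
open MeasureTheory ProbabilityTheory

lemma rrt_comb (n : ℕ) (p : ℕ → ℕ → ℝ) (h10 : p 1 0 = 1) (h1 : ∀ j, p 1 (j+1) = 0)
    (h0 : ∀ k, 2 ≤ k → k ≤ n → p k 0 = 0)
    (hrec : ∀ k, 2 ≤ k → k ≤ n → ∀ j, p k (j+1) = 1 / ((k:ℝ) - 1) * ∑ i ∈ Finset.Ico 1 k, p i j)
    (m : ℕ) (hm : 2 ≤ m) : m ≤ n → ∀ j, ∑ i ∈ Finset.Ico 1 m, p i j =
      ∑ s ∈ (Finset.Ioo 1 m).powersetCard j, ∏ i ∈ s, 1 / ((i : ℝ) - 1) := by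
  induction m, hm using Nat.le_induction with
  | base =>
    intro _ j
    have e : Finset.Ioo 1 2 = (∅ : Finset ℕ) := by decide
    have e' : Finset.Ico 1 2 = ({1} : Finset ℕ) := by decide
    rw [e, e']
    rcases j with _ | j
    · simp [h10]
    · rw [Finset.powersetCard_eq_empty.2 (by simp)]
      simp [h1]
  | succ m hm ih =>
    intro hmn j
    have e : Finset.Ioo 1 (m+1) = insert m (Finset.Ioo 1 m) := by
      ext x; simp only [Finset.mem_Ioo, Finset.mem_insert]; omega
    have hnot : m ∉ Finset.Ioo 1 m := by simp
    rw [Finset.sum_Ico_succ_top (by omega), ih (by omega), e]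
    rcases j with _ | j
    · simp [h0 m hm (by omega)]
    · rw [Finset.powersetCard_succ_insert hnot, Finset.sum_union, hrec m hm (by omega), ih (by omega)]
      · congr 1
        rw [Finset.sum_image, Finset.mul_sum]
        · refine Finset.sum_congr rfl fun s hs => ?_
          rw [Finset.prod_insert]
          intro h
          exact hnot ((Finset.mem_powersetCard.1 hs).1 h)
        · intro s hs t ht hst
          have hs' : m ∉ s := fun h => hnot ((Finset.mem_powersetCard.1 hs).1 h)
          have ht' : m ∉ t := fun h => hnot ((Finset.mem_powersetCard.1 ht).1 h)
          rw [← Finset.erase_insert hs', ← Finset.erase_insert ht']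
          exact congrArg (fun u => Finset.erase u m) hst
      · rw [Finset.disjoint_left]
        intro s hs hs2
        obtain ⟨t, _, rfl⟩ := Finset.mem_image.1 hs2
        exact hnot ((Finset.mem_powersetCard.1 hs).1 (Finset.mem_insert_self _ _))

theorem stmt10 (n : ℕ) (hn : 1 ≤ n)
    (Ω : Type*) [MeasurableSpace Ω] (P : Measure Ω) [IsProbabilityMeasure P]
    (U : ℕ → Ω → ℕ) (hUmeas : ∀ k, Measurable (U k))
    (hUrange : ∀ k, 2 ≤ k → k ≤ n → ∀ ω, U k ω ∈ Finset.Icc 1 (k - 1))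
    (hUunif : ∀ k, 2 ≤ k → k ≤ n → ∀ j ∈ Finset.Icc 1 (k - 1),
      P {ω | U k ω = j} = ((k - 1 : ℕ) : ENNReal)⁻¹)
    (hUindep : iIndepFun (m := fun _ => inferInstance)
      (fun k : {k : ℕ // 2 ≤ k ∧ k ≤ n} => U k.1) P)
    (d : ℕ → Ω → ℕ) (hdmeas : ∀ k, Measurable (d k))
    (hd1 : ∀ ω, d 1 ω = 0)
    (hdrec : ∀ k, 2 ≤ k → k ≤ n → ∀ ω, d k ω = d (U k ω) ω + 1)
    (k j : ℕ) (hk2 : 2 ≤ k) (hkn : k ≤ n) (hj : 1 ≤ j) :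
    (P {ω | d k ω = j}).toReal
      = 1 / ((k : ℝ) - 1) *
          ∑ s ∈ (Finset.Ioo 1 k).powersetCard (j - 1),
            ∏ i ∈ s, 1 / ((i : ℝ) - 1) := by
  -- determinism
  have hdet : ∀ k, k ≤ n → ∀ ω ω', (∀ l, 2 ≤ l → l < k → U l ω = U l ω') →
      ∀ i, 1 ≤ i → i < k → d i ω = d i ω' := by
    intro k hk ω ω' h i
    induction i using Nat.strong_induction_on with
    | _ i ih =>
      intro h1 hik
      rcases Nat.lt_or_ge i 2 with h2 | h2
      · obtain rfl : i = 1 := by omega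
        rw [hd1, hd1]
      · rw [hdrec i h2 (by omega), hdrec i h2 (by omega), ← h i h2 hik]
        have := Finset.mem_Icc.1 (hUrange i h2 (by omega) ω)
        rw [ih (U i ω) (by omega) this.1 (by omega)]
  have hind : ∀ k, 2 ≤ k → k ≤ n → ∀ i, 1 ≤ i → i < k → IndepFun (U k) (d i) P := by
    intro k hk2 hkn i hi1 hik
    let kk : {k : ℕ // 2 ≤ k ∧ k ≤ n} := ⟨k, hk2, hkn⟩
    let S : Finset {k : ℕ // 2 ≤ k ∧ k ≤ n} := Finset.subtype _ (Finset.Ico 2 k)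
    have hdisj : Disjoint ({kk} : Finset _) S := by
      rw [Finset.disjoint_singleton_left]
      simp [S, kk]
    have key := hUindep.indepFun_finset {kk} S hdisj (fun i => hUmeas i.1)
    let F : Ω → (S → ℕ) := fun ω l => U l.1.1 ω
    have hfac : Function.FactorsThrough (d i) F := by
      intro ω ω' hF
      refine hdet k hkn ω ω' ?_ i hi1 hik
      intro l h2 hl
      exact congrFun hF ⟨⟨l, h2, by omega⟩, by simp [S, h2, hl]⟩
    have hφ : Measurable (fun f : (({kk} : Finset {k : ℕ // 2 ≤ k ∧ k ≤ n}) → ℕ) =>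
        f ⟨kk, Finset.mem_singleton_self kk⟩) := measurable_of_countable _
    have hψ : Measurable (Function.extend F (d i) (fun _ => 0)) := measurable_of_countable _
    have key2 := key.comp hφ hψ
    have e : Function.extend F (d i) (fun _ => 0) ∘ F = d i := by
      ext ω
      exact hfac.extend_apply _ ω
    rw [← e]
    exact key2
  have hrec : ∀ k, 2 ≤ k → k ≤ n → ∀ j, (P {ω | d k ω = j + 1}).toReal =
      1 / ((k:ℝ) - 1) * ∑ i ∈ Finset.Ico 1 k, (P {ω | d i ω = j}).toReal := by
    intro k hk2 hkn j
    have hset : {ω | d k ω = j + 1} =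
        ⋃ i ∈ Finset.Ico 1 k, (U k ⁻¹' {i} ∩ d i ⁻¹' {j}) := by
      ext ω
      have := Finset.mem_Icc.1 (hUrange k hk2 hkn ω)
      simp only [Set.mem_ofPred_eq, Set.mem_iUnion, Set.mem_inter_iff, Set.mem_preimage,
        Set.mem_singleton_iff, hdrec k hk2 hkn ω, Finset.mem_Ico]
      constructor
      · intro h
        exact ⟨U k ω, by omega, rfl, by omega⟩
      · rintro ⟨i, _, rfl, h⟩
        omega
    rw [hset, measure_biUnion_finset, ENNReal.toReal_sum (fun _ _ => measure_ne_top _ _),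
      Finset.mul_sum]
    · refine Finset.sum_congr rfl fun i hi => ?_
      rw [Finset.mem_Ico] at hi
      rw [(hind k hk2 hkn i hi.1 hi.2).measure_inter_preimage_eq_mul _ _
        (MeasurableSet.singleton _) (MeasurableSet.singleton _), ENNReal.toReal_mul]
      have := hUunif k hk2 hkn i (Finset.mem_Icc.2 ⟨hi.1, by omega⟩)
      change (P {ω | U k ω = i}).toReal * (P {ω | d i ω = j}).toReal = _
      rw [this, ENNReal.toReal_inv, ENNReal.toReal_natCast, Nat.cast_sub (by omega)]
      simp
    · intro a _ b _ hab
      refine Set.disjoint_left.2 ?_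
      rintro ω ⟨h1, _⟩ ⟨h2, _⟩
      exact hab (h1.symm.trans h2)
    · intro i _
      exact (hUmeas k (MeasurableSet.singleton _)).inter (hdmeas i (MeasurableSet.singleton _))
  obtain ⟨j, rfl⟩ : ∃ j', j = j' + 1 := ⟨j - 1, by omega⟩
  rw [hrec k hk2 hkn j, Nat.add_sub_cancel]
  rw [rrt_comb n (fun i j => (P {ω | d i ω = j}).toReal) ?_ ?_ ?_ hrec k hk2 hkn j]
  · simp [hd1]
  · intro j; simp [hd1]
  · intro k h2 hk
    simp [hdrec k h2 hk]
end

section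
/- In a random recursive tree on n vertices, for every k with 2 ≤ k ≤ n and every integer j ≥ 1, P(d_k = j) ≤ (1 + log k)^(j−1) / ((k−1) · (j−1)!). -/
open MeasureTheory ProbabilityTheory

lemma aux_pow (a x : ℝ) (ha : 0 ≤ a) (hx : 0 ≤ x) (m : ℕ) :
    a ^ (m+1) + (m+1) * (a ^ m * x) ≤ (a + x) ^ (m+1) := by
  induction m with
  | zero => simp
  | succ m ih =>
    have h1 : (a + x) * (a ^ (m+1) + (m+1) * (a ^ m * x)) ≤ (a + x) * (a + x) ^ (m+1) :=
      mul_le_mul_of_nonneg_left ih (by positivity)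
    have h2 : 0 ≤ (m+1) * (a ^ m * x) * x := by positivity
    push_cast
    calc _ ≤ (a + x) * (a ^ (m+1) + (m+1) * (a ^ m * x)) := by
            rw [← sub_nonneg]; ring_nf; ring_nf at h2; linarith
      _ ≤ _ := h1
      _ = _ := by ring

lemma aux_meas (n : ℕ) {Ω : Type*} [MeasurableSpace Ω]
    (U : ℕ → Ω → ℕ)
    (hUrange : ∀ k, 2 ≤ k → k ≤ n → ∀ ω, U k ω ∈ Finset.Icc 1 (k - 1))
    (d : ℕ → Ω → ℕ) (hd1 : ∀ ω, d 1 ω = 0)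
    (hdrec : ∀ k, 2 ≤ k → k ≤ n → ∀ ω, d k ω = d (U k ω) ω + 1) (m : MeasurableSpace Ω) (K : ℕ)
    (hm : ∀ k, 2 ≤ k → k ≤ n → k ≤ K → Measurable[m] (U k))
    (i : ℕ) (hi1 : 1 ≤ i) (hin : i ≤ n) (hiK : i ≤ K) : Measurable[m] (d i) := by
  induction i using Nat.strong_induction_on with
  | _ i ih =>
  rcases hi1.eq_or_lt with h | h
  · subst h
    have : d 1 = fun _ => 0 := funext hd1
    rw [this]; exact measurable_const
  · refine measurable_to_countable' fun v => ?_
    have : d i ⁻¹' {v} = ⋃ l ∈ Finset.Icc 1 (i-1), (U i ⁻¹' {l} ∩ d l ⁻¹' {w | w + 1 = v}) := by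
      ext ω
      simp only [Set.mem_preimage, Set.mem_singleton_iff, Set.mem_iUnion, Set.mem_inter_iff,
        Set.mem_ofPred_eq, exists_prop]
      rw [hdrec i h hin ω]
      constructor
      · intro hv; exact ⟨U i ω, hUrange i h hin ω, rfl, hv⟩
      · rintro ⟨l, _, rfl, hv⟩; exact hv
    rw [this]
    refine Finset.measurableSet_biUnion _ fun l hl => ?_
    rw [Finset.mem_Icc] at hl
    exact (hm i h hin hiK (MeasurableSet.singleton _)).inter
      (ih l (by omega) hl.1 (by omega) (by omega) (MeasurableSet.of_discrete))

lemma aux_real (n : ℕ) (p : ℕ → ℕ → ℝ) (h10 : p 1 0 ≤ 1) (h1 : ∀ j, p 1 (j+1) = 0)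
    (h0 : ∀ k, 2 ≤ k → k ≤ n → p k 0 = 0)
    (hrec : ∀ k j, 2 ≤ k → k ≤ n →
      p k (j+1) = ((k:ℝ) - 1)⁻¹ * ∑ i ∈ Finset.Icc 1 (k-1), p i j) (j : ℕ) :
    ∀ k, k + 2 ≤ n → p (k+2) (j+1) ≤ (harmonic k : ℝ) ^ j / (((k:ℝ)+1) * (j.factorial : ℝ)) := by
  have hh : ∀ k, (0:ℝ) ≤ (harmonic k : ℝ) := by
    intro k; unfold harmonic; push_cast; positivity
  have key : ∀ j k, k + 2 ≤ n → (∑ i ∈ Finset.Icc 1 (k+1), p i j ≤ (harmonic k : ℝ)^j / j.factorial)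
      → p (k+2) (j+1) ≤ (harmonic k : ℝ) ^ j / (((k:ℝ)+1) * (j.factorial : ℝ)) := by
    intro j k hk h
    rw [hrec (k+2) j (by omega) hk]
    have e : ((k+2:ℕ):ℝ) - 1 = k + 1 := by push_cast; ring
    rw [e, show k + 2 - 1 = k + 1 by omega, mul_comm ((k:ℝ)+1), ← div_div, inv_mul_eq_div]
    gcongr
  induction j with
  | zero =>
    intro k hk
    refine key 0 k hk ?_
    rw [Finset.sum_eq_single_of_mem 1 (by simp)]
    · simpa using h10
    · intro b hb hb1
      rw [Finset.mem_Icc] at hb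
      exact h0 b (by omega) (by omega)
  | succ j ih =>
    intro k hk
    refine key (j+1) k hk ?_
    clear key
    induction k with
    | zero => simp [h1]
    | succ k ihk =>
      rw [Finset.sum_Icc_succ_top (by omega)]
      have a := ihk (by omega)
      have b := ih k (by omega)
      have c := aux_pow (harmonic k) ((k:ℝ)+1)⁻¹ (hh k) (by positivity) j
      have e : (harmonic (k+1) : ℝ) = harmonic k + ((k:ℝ)+1)⁻¹ := by
        rw [harmonic_succ]; push_cast; rfl
      rw [e]
      refine (add_le_add a b).trans ?_
      have f : ((j+1).factorial : ℝ) = (j+1) * j.factorial := by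
        rw [Nat.factorial_succ]; push_cast; rfl
      have g : (0:ℝ) < (j+1).factorial := by positivity
      have g' : (0:ℝ) < j.factorial := by positivity
      refine le_trans (le_of_eq ?_) (div_le_div_of_nonneg_right c g.le)
      rw [f]
      field_simp

/-- In a random recursive tree on `n` vertices, for `2 ≤ k ≤ n` and `j ≥ 1`,
`P(d_k = j) ≤ (1 + log k)^(j−1) / ((k−1)·(j−1)!)`. -/
theorem stmt11 (n : ℕ) (hn : 1 ≤ n)
    (Ω : Type*) [MeasurableSpace Ω] (P : Measure Ω) [IsProbabilityMeasure P]
    (U : ℕ → Ω → ℕ) (hUmeas : ∀ k, Measurable (U k))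
    (hUrange : ∀ k, 2 ≤ k → k ≤ n → ∀ ω, U k ω ∈ Finset.Icc 1 (k - 1))
    (hUunif : ∀ k, 2 ≤ k → k ≤ n → ∀ j ∈ Finset.Icc 1 (k - 1),
      P {ω | U k ω = j} = ((k - 1 : ℕ) : ENNReal)⁻¹)
    (hUindep : iIndepFun
      (fun k : {k : ℕ // 2 ≤ k ∧ k ≤ n} => U k.1) P)
    (d : ℕ → Ω → ℕ) (hdmeas : ∀ k, Measurable (d k))
    (hd1 : ∀ ω, d 1 ω = 0)
    (hdrec : ∀ k, 2 ≤ k → k ≤ n → ∀ ω, d k ω = d (U k ω) ω + 1)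
    (k j : ℕ) (hk2 : 2 ≤ k) (hkn : k ≤ n) (hj : 1 ≤ j) :
    (P {ω | d k ω = j}).toReal
      ≤ (1 + Real.log k) ^ (j - 1) / (((k : ℝ) - 1) * ((j - 1).factorial : ℝ)) := by
  have hrec : ∀ k j, 2 ≤ k → k ≤ n → P.real {ω | d k ω = j+1}
      = ((k:ℝ) - 1)⁻¹ * ∑ i ∈ Finset.Icc 1 (k-1), P.real {ω | d i ω = j} := by
    intro k j hk hkn
    have hset : {ω | d k ω = j+1} =
        ⋃ l ∈ Finset.Icc 1 (k-1), ({ω | U k ω = l} ∩ {ω | d l ω = j}) := by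
      ext ω
      simp only [Set.mem_iUnion, Set.mem_inter_iff, Set.mem_ofPred_eq, exists_prop]
      rw [hdrec k hk hkn ω]
      constructor
      · intro hv; exact ⟨U k ω, hUrange k hk hkn ω, rfl, by omega⟩
      · rintro ⟨l, _, rfl, hv⟩; omega
    have hmU : ∀ l, MeasurableSet {ω | U k ω = l} := fun l =>
      hUmeas k (MeasurableSet.singleton l)
    have hmd : ∀ l, MeasurableSet {ω | d l ω = j} := fun l =>
      hdmeas l (MeasurableSet.singleton j)
    rw [hset, measureReal_biUnion_finset, Finset.mul_sum]
    · refine Finset.sum_congr rfl fun l hl => ?_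
      have hl' := Finset.mem_Icc.1 hl
      have hind := indep_iSup_of_disjoint
        (m := fun q : {k : ℕ // 2 ≤ k ∧ k ≤ n} => MeasurableSpace.comap (U q.1) inferInstance)
        (fun q => (hUmeas q.1).comap_le) hUindep.iIndep
        (S := {⟨k, hk, hkn⟩}) (T := {q | q.1 < k})
        (by rw [Set.disjoint_singleton_left]; simp)
      have h2 := (Indep_iff _ _ P).1 hind {ω | U k ω = l} {ω | d l ω = j} ?_ ?_
      · rw [measureReal_def, h2, hUunif k hk hkn l hl, ENNReal.toReal_mul, measureReal_def]
        congr 1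
        rw [ENNReal.toReal_inv, ENNReal.toReal_natCast, Nat.cast_sub (by omega), Nat.cast_one]
      · have hle : MeasurableSpace.comap (U k) inferInstance ≤
            ⨆ q ∈ ({⟨k, hk, hkn⟩} : Set {k : ℕ // 2 ≤ k ∧ k ≤ n}),
              MeasurableSpace.comap (U q.1) inferInstance :=
          le_iSup₂_of_le (⟨k, hk, hkn⟩ : {k : ℕ // 2 ≤ k ∧ k ≤ n}) (Set.mem_singleton _) le_rfl
        exact hle _ ⟨{l}, MeasurableSet.singleton l, rfl⟩
      · refine aux_meas n U hUrange d hd1 hdrec _ l ?_ l hl'.1 (by omega) le_rfl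
          (MeasurableSet.singleton j)
        intro q hq hqn hql
        rw [measurable_iff_comap_le]
        exact le_iSup₂_of_le (⟨q, hq, hqn⟩ : {k : ℕ // 2 ≤ k ∧ k ≤ n})
          (show q < k by omega) le_rfl
    · intro a _ b _ hab
      refine Set.disjoint_left.2 ?_
      rintro ω ⟨h1, _⟩ ⟨h2, _⟩
      exact hab (h1.symm.trans h2)
    · intro l _
      exact (hmU l).inter (hmd l)
  obtain ⟨k, rfl⟩ : ∃ q, k = q + 2 := ⟨k - 2, by omega⟩
  obtain ⟨j, rfl⟩ : ∃ q, j = q + 1 := ⟨j - 1, by omega⟩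
  have main := aux_real n (fun k j => P.real {ω | d k ω = j}) measureReal_le_one
    (by intro j; simp [hd1]) (by
      intro k hk hkn
      have : {ω | d k ω = 0} = ∅ := by
        ext ω; simp [hdrec k hk hkn ω]
      simp [this]) hrec j k hkn
  refine main.trans ?_
  have e : ((k+2:ℕ):ℝ) - 1 = k + 1 := by push_cast; ring
  rw [e, Nat.add_sub_cancel]
  have h0 : (0:ℝ) ≤ (harmonic k : ℝ) := by
    unfold harmonic; push_cast; positivity
  have h3 : (harmonic k : ℝ) ≤ 1 + Real.log ((k+2:ℕ):ℝ) := by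
    have hs : (harmonic k : ℝ) ≤ (harmonic (k+2) : ℝ) := by
      rw [harmonic_succ, harmonic_succ]; push_cast
      have : (0:ℝ) ≤ ((k:ℝ)+1)⁻¹ := by positivity
      have : (0:ℝ) ≤ ((k:ℝ)+1+1)⁻¹ := by positivity
      linarith
    exact hs.trans (harmonic_le_one_add_log _)
  gcongr
end

section
/- There exists a positive constant C such that in a random recursive tree on n vertices, for every k with 2 ≤ k ≤ n, E[d_k²] ≤ C · (log k)². -/
open MeasureTheory ProbabilityTheory

section helpers
variable {Ω : Type*} [MeasurableSpace Ω] (P : Measure Ω) [IsProbabilityMeasure P]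
  {n : ℕ} {U d : ℕ → Ω → ℕ}

lemma d_repr (hmem : ∀ k, 2 ≤ k → k ≤ n → ∀ ω, U k ω ∈ Finset.Icc 1 (k - 1))
    (hd : ∀ k, 2 ≤ k → k ≤ n → ∀ ω, d k ω = d (U k ω) ω + 1)
    (f : ℕ → ℝ) (k : ℕ) (h2 : 2 ≤ k) (hk : k ≤ n) (ω : Ω) :
    f (d k ω) = ∑ j ∈ Finset.Icc 1 (k - 1),
      (if U k ω = j then (1 : ℝ) else 0) * f (d j ω + 1) := by
  simp only [ite_mul, one_mul, zero_mul]
  rw [Finset.sum_ite_eq, if_pos (hmem k h2 hk ω), hd k h2 hk ω]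

lemma d_meas (F : MeasurableSpace Ω) (k : ℕ)
    (hmem : ∀ k, 2 ≤ k → k ≤ n → ∀ ω, U k ω ∈ Finset.Icc 1 (k - 1))
    (h1 : ∀ ω, d 1 ω = 0)
    (hd : ∀ k, 2 ≤ k → k ≤ n → ∀ ω, d k ω = d (U k ω) ω + 1)
    (hF : ∀ i, 2 ≤ i → i ≤ n → i < k → Measurable[F] (U i)) :
    ∀ j, 1 ≤ j → j ≤ n → j < k → Measurable[F] (d j) := by
  intro j
  induction j using Nat.strong_induction_on with
  | _ j ih =>
    intro hj1 hjn hjk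
    rcases Nat.lt_or_ge j 2 with h | h
    · obtain rfl : j = 1 := by omega
      have : d 1 = fun _ => 0 := funext h1
      rw [this]; exact measurable_const
    · have : d j = fun ω => ∑ i ∈ Finset.Icc 1 (j - 1),
          (if U j ω = i then d i ω + 1 else 0) := by
        funext ω
        rw [Finset.sum_ite_eq, if_pos (hmem j h hjn ω), hd j h hjn ω]
      rw [this]
      refine Finset.measurable_sum _ (fun i hi => ?_)
      rw [Finset.mem_Icc] at hi
      refine Measurable.ite ?_ ?_ measurable_const
      · exact hF j h hjn hjk (measurableSet_singleton i)
      · exact (ih i (by omega) hi.1 (by omega) (by omega)).add_const 1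

lemma d_indep (hU : ∀ k, Measurable (U k))
    (hmem : ∀ k, 2 ≤ k → k ≤ n → ∀ ω, U k ω ∈ Finset.Icc 1 (k - 1))
    (hind : iIndepFun (fun k : {k : ℕ // 2 ≤ k ∧ k ≤ n} => U k.1) P)
    (h1 : ∀ ω, d 1 ω = 0)
    (hd : ∀ k, 2 ≤ k → k ≤ n → ∀ ω, d k ω = d (U k ω) ω + 1)
    (k : ℕ) (h2 : 2 ≤ k) (hk : k ≤ n) (j : ℕ) (hj : 1 ≤ j) (hjk : j < k) :
    IndepFun (U k) (d j) P := by
  have hi := indep_iSup_of_disjoint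
    (m := fun i : {k : ℕ // 2 ≤ k ∧ k ≤ n} => MeasurableSpace.comap (U i.1) ⊤)
    (μ := P) (fun i => (hU i.1).comap_le) hind
    (S := {⟨k, h2, hk⟩}) (T := {i | i.1 < k}) (by
      rw [Set.disjoint_left]; rintro a rfl; simp)
  rw [IndepFun_iff_Indep]
  refine indep_of_indep_of_le_left (indep_of_indep_of_le_right hi ?_) ?_
  · apply Measurable.comap_le
    refine d_meas _ k hmem h1 hd ?_ j hj (by omega) hjk
    intro i hi2 hin hik
    rw [measurable_iff_comap_le]
    exact le_iSup₂_of_le (f := fun (i : {k : ℕ // 2 ≤ k ∧ k ≤ n})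
      (_ : i ∈ {i : {k : ℕ // 2 ≤ k ∧ k ≤ n} | i.1 < k}) => MeasurableSpace.comap (U i.1) ⊤)
      ⟨i, hi2, hin⟩ hik le_rfl
  · simp
    exact le_rfl

lemma d_le (h1 : ∀ ω, d 1 ω = 0)
    (hmem : ∀ k, 2 ≤ k → k ≤ n → ∀ ω, U k ω ∈ Finset.Icc 1 (k - 1))
    (hd : ∀ k, 2 ≤ k → k ≤ n → ∀ ω, d k ω = d (U k ω) ω + 1) (ω : Ω) :
    ∀ j, 1 ≤ j → j ≤ n → d j ω ≤ j := by
  intro j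
  induction j using Nat.strong_induction_on with
  | _ j ih =>
    intro hj hn
    rcases Nat.lt_or_ge j 2 with h | h
    · obtain rfl : j = 1 := by omega
      rw [h1]; omega
    · have := hmem j h hn ω
      rw [Finset.mem_Icc] at this
      have := ih (U j ω) (by omega) (by omega) (by omega)
      rw [hd j h hn]; omega

lemma d_int (hdm : ∀ k, Measurable (d k)) (h1 : ∀ ω, d 1 ω = 0)
    (hmem : ∀ k, 2 ≤ k → k ≤ n → ∀ ω, U k ω ∈ Finset.Icc 1 (k - 1))
    (hd : ∀ k, 2 ≤ k → k ≤ n → ∀ ω, d k ω = d (U k ω) ω + 1) (f : ℕ → ℝ)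
    (j : ℕ) (hj : 1 ≤ j) (hn : j ≤ n) : Integrable (fun ω => f (d j ω)) P := by
  refine Integrable.of_bound (C := ∑ i ∈ Finset.range (j+1), ‖f i‖)
    ((measurable_from_top (f := f)).comp (hdm j)).aestronglyMeasurable
    (Filter.Eventually.of_forall fun ω => ?_)
  exact Finset.single_le_sum (f := fun i => ‖f i‖) (fun i _ => norm_nonneg _)
    (Finset.mem_range.2 (Nat.lt_succ_of_le (d_le h1 hmem hd ω j hj hn)))

lemma d_rec (hU : ∀ k, Measurable (U k))
    (hmem : ∀ k, 2 ≤ k → k ≤ n → ∀ ω, U k ω ∈ Finset.Icc 1 (k - 1))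
    (hP : ∀ k, 2 ≤ k → k ≤ n → ∀ j ∈ Finset.Icc 1 (k - 1),
      P {ω | U k ω = j} = ((k - 1 : ℕ) : ENNReal)⁻¹)
    (hind : iIndepFun (fun k : {k : ℕ // 2 ≤ k ∧ k ≤ n} => U k.1) P)
    (hdm : ∀ k, Measurable (d k)) (h1 : ∀ ω, d 1 ω = 0)
    (hd : ∀ k, 2 ≤ k → k ≤ n → ∀ ω, d k ω = d (U k ω) ω + 1)
    (f : ℕ → ℝ) (k : ℕ) (hk1 : 1 ≤ k) (hk : k + 1 ≤ n) :
    k * ∫ ω, f (d (k+1) ω) ∂P = ∑ j ∈ Finset.Icc 1 k, ∫ ω, f (d j ω + 1) ∂P := by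
  have hk0 : (k : ℝ) ≠ 0 := by positivity
  have hm : ∀ j, Measurable (fun ω => if U (k+1) ω = j then (1 : ℝ) else 0) := fun j =>
    Measurable.ite (hU (k+1) (measurableSet_singleton j)) measurable_const measurable_const
  have hint : ∀ j ∈ Finset.Icc 1 k, Integrable (fun ω => f (d j ω + 1)) P := by
    intro j hj
    rw [Finset.mem_Icc] at hj
    exact d_int P hdm h1 hmem hd (fun i => f (i+1)) j hj.1 (by omega)
  simp_rw [d_repr hmem hd f (k+1) (by omega) hk, Nat.add_sub_cancel]
  rw [integral_finsetSum, Finset.mul_sum]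
  · refine Finset.sum_congr rfl fun j hj => ?_
    have hj' := Finset.mem_Icc.1 hj
    have hi := d_indep P hU hmem hind h1 hd (k+1) (by omega) hk j hj'.1 (by omega)
    have hi2 : IndepFun (fun ω => if U (k+1) ω = j then (1 : ℝ) else 0)
        (fun ω => f (d j ω + 1)) P :=
      hi.comp (φ := fun i => if i = j then (1:ℝ) else 0) (ψ := fun i => f (i+1))
        measurable_from_top measurable_from_top
    rw [hi2.integral_fun_mul_eq_mul_integral (hm j).aestronglyMeasurable
      (hint j hj).aestronglyMeasurable]
    have : ∫ ω, (if U (k+1) ω = j then (1 : ℝ) else 0) ∂P = (k : ℝ)⁻¹ := by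
      have e : (fun ω => if U (k+1) ω = j then (1 : ℝ) else 0)
          = Set.indicator {ω | U (k+1) ω = j} 1 := by
        funext ω; simp [Set.indicator_apply]
      have ms : MeasurableSet {ω | U (k+1) ω = j} := hU (k+1) (measurableSet_singleton j)
      rw [e, integral_indicator_one ms, measureReal_def,
        hP (k+1) (by omega) hk j (by simpa using hj)]
      simp
    rw [this]; field_simp
  · intro j hj
    refine (hint j hj).bdd_mul (c := 1) (hm j).aestronglyMeasurable
      (Filter.Eventually.of_forall fun ω => ?_)
    split_ifs <;> simp

lemma d_step (hU : ∀ k, Measurable (U k))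
    (hmem : ∀ k, 2 ≤ k → k ≤ n → ∀ ω, U k ω ∈ Finset.Icc 1 (k - 1))
    (hP : ∀ k, 2 ≤ k → k ≤ n → ∀ j ∈ Finset.Icc 1 (k - 1),
      P {ω | U k ω = j} = ((k - 1 : ℕ) : ENNReal)⁻¹)
    (hind : iIndepFun (fun k : {k : ℕ // 2 ≤ k ∧ k ≤ n} => U k.1) P)
    (hdm : ∀ k, Measurable (d k)) (h1 : ∀ ω, d 1 ω = 0)
    (hd : ∀ k, 2 ≤ k → k ≤ n → ∀ ω, d k ω = d (U k ω) ω + 1)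
    (f : ℕ → ℝ) (k : ℕ) (hk1 : 1 ≤ k) (hk : k + 1 ≤ n) :
    ∫ ω, f (d (k+1) ω) ∂P = ∫ ω, f (d k ω) ∂P
      + (∫ ω, (f (d k ω + 1) - f (d k ω)) ∂P) / k := by
  have hk0 : (k : ℝ) ≠ 0 := by positivity
  have A := d_rec P hU hmem hP hind hdm h1 hd f k hk1 hk
  rw [integral_sub (d_int P hdm h1 hmem hd (fun i => f (i+1)) k hk1 (by omega))
    (d_int P hdm h1 hmem hd f k hk1 (by omega))]
  obtain ⟨m, rfl⟩ : ∃ m, k = m + 1 := ⟨k - 1, by omega⟩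
  rw [Finset.sum_Icc_succ_top (by omega)] at A
  have B : (m : ℝ) * ∫ ω, f (d (m+1) ω) ∂P
      = ∑ j ∈ Finset.Icc 1 m, ∫ ω, f (d j ω + 1) ∂P := by
    rcases Nat.eq_zero_or_pos m with rfl | hm
    · simp
    · exact d_rec P hU hmem hP hind hdm h1 hd f m hm (by omega)
  rw [← B] at A
  field_simp
  push_cast at A ⊢
  linarith

lemma d_main (hU : ∀ k, Measurable (U k))
    (hmem : ∀ k, 2 ≤ k → k ≤ n → ∀ ω, U k ω ∈ Finset.Icc 1 (k - 1))
    (hP : ∀ k, 2 ≤ k → k ≤ n → ∀ j ∈ Finset.Icc 1 (k - 1),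
      P {ω | U k ω = j} = ((k - 1 : ℕ) : ENNReal)⁻¹)
    (hind : iIndepFun (fun k : {k : ℕ // 2 ≤ k ∧ k ≤ n} => U k.1) P)
    (hdm : ∀ k, Measurable (d k)) (h1 : ∀ ω, d 1 ω = 0)
    (hd : ∀ k, 2 ≤ k → k ≤ n → ∀ ω, d k ω = d (U k ω) ω + 1)
    (k : ℕ) (hk : k + 1 ≤ n) :
    ∫ ω, (d (k+1) ω : ℝ) ∂P = (harmonic k : ℝ) ∧
    ∫ ω, (d (k+1) ω : ℝ) ^ 2 ∂P ≤ (harmonic k : ℝ) ^ 2 + harmonic k := by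
  induction k with
  | zero => simp [h1]
  | succ k ih =>
    obtain ⟨ih1, ih2⟩ := ih (by omega)
    have s1 := d_step P hU hmem hP hind hdm h1 hd (fun i => (i : ℝ)) (k+1) (by omega) hk
    have s2 := d_step P hU hmem hP hind hdm h1 hd (fun i => (i : ℝ)^2) (k+1) (by omega) hk
    have e2 : ∫ ω, (((d (k+1) ω + 1 : ℕ) : ℝ)^2 - (d (k+1) ω : ℝ)^2) ∂P
        = 2 * harmonic k + 1 := by
      have : ∀ ω, (((d (k+1) ω + 1 : ℕ) : ℝ)^2 - (d (k+1) ω : ℝ)^2)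
          = 2 * (d (k+1) ω : ℝ) + 1 := by intro ω; push_cast; ring
      simp_rw [this]
      rw [integral_add ((d_int P hdm h1 hmem hd (fun i => (i:ℝ)) (k+1) (by omega)
        (by omega)).const_mul 2) (integrable_const _), integral_const_mul, ih1]
      simp
    have e1 : ∫ ω, (((d (k+1) ω + 1 : ℕ) : ℝ) - (d (k+1) ω : ℝ)) ∂P = 1 := by
      simp
    simp only [e1, e2, ih1] at s1 s2
    rw [s1, s2, harmonic_succ]
    push_cast
    refine ⟨by rw [one_div], ?_⟩
    rw [div_eq_mul_inv]
    nlinarith [sq_nonneg ((k : ℝ) + 1)⁻¹]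

end helpers

/-- There is a positive constant `C` such that in any random recursive tree on `n`
vertices, for every `2 ≤ k ≤ n`, `E[d_k²] ≤ C·(log k)²`. -/
theorem stmt12 : ∃ C : ℝ, 0 < C ∧ ∀ (n : ℕ), 1 ≤ n →
    ∀ (Ω : Type*) [MeasurableSpace Ω] (P : Measure Ω) [IsProbabilityMeasure P]
      (U : ℕ → Ω → ℕ), (∀ k, Measurable (U k)) →
    (∀ k, 2 ≤ k → k ≤ n → ∀ ω, U k ω ∈ Finset.Icc 1 (k - 1)) →
    (∀ k, 2 ≤ k → k ≤ n → ∀ j ∈ Finset.Icc 1 (k - 1),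
      P {ω | U k ω = j} = ((k - 1 : ℕ) : ENNReal)⁻¹) →
    iIndepFun
      (fun k : {k : ℕ // 2 ≤ k ∧ k ≤ n} => U k.1) P →
    ∀ (d : ℕ → Ω → ℕ), (∀ k, Measurable (d k)) →
    (∀ ω, d 1 ω = 0) →
    (∀ k, 2 ≤ k → k ≤ n → ∀ ω, d k ω = d (U k ω) ω + 1) →
    ∀ k, 2 ≤ k → k ≤ n →
      ∫ ω, (d k ω : ℝ) ^ 2 ∂P ≤ C * (Real.log k) ^ 2 := by
  refine ⟨15, by norm_num, ?_⟩
  intro n _ Ω _ P _ U hU hmem hP hind d hdm h1 hd k h2 hk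
  obtain ⟨m, rfl⟩ : ∃ m, k = m + 1 := ⟨k - 1, by omega⟩
  refine (d_main P hU hmem hP hind hdm h1 hd m hk).2.trans ?_
  have hm : 1 ≤ m := by omega
  have a : (harmonic m : ℝ) ≤ 1 + Real.log m := harmonic_le_one_add_log m
  have b : Real.log m ≤ Real.log ((m + 1 : ℕ) : ℝ) :=
    Real.log_le_log (by positivity) (by push_cast; linarith)
  have c : Real.log 2 ≤ Real.log ((m + 1 : ℕ) : ℝ) :=
    Real.log_le_log (by norm_num) (by exact_mod_cast h2)
  have c2 := Real.log_two_gt_d9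
  have p : (0:ℝ) ≤ harmonic m := by
    have := harmonic_pos (n := m) (by omega)
    exact_mod_cast this.le
  generalize Real.log ((m + 1 : ℕ) : ℝ) = L at *
  have q : (harmonic m : ℝ) ≤ 5/2 * L := by linarith
  nlinarith
end

section
/- Let f: ℝ → ℝ be twice continuously differentiable, constant on (−∞, z] for some real z, and such that f, f′, f″ are bounded and tend to 0 at +∞. For t > 0 and x ∈ ℝ define P_t f(x) = ∫_{x−t}^{∞} f(y) · exp(−e^{−y}(1 − e^{−t})) · e^{−y}(1 − e^{−t}) dy + f(x−t) · exp(−e^{−(x−t)}(1 − e^{−t})), and define A f(x) = −f′(x) + ∫_x^{∞} e^{−y}(f(y) − f(x)) dy. Then sup_{x ∈ ℝ} |(P_t f(x) − f(x))/t − A f(x)| → 0 as t → 0+. -/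
open MeasureTheory

lemma aux_exp (w : ℝ) (hw : 0 ≤ w) : Real.exp (-w) ≤ 1 - w + w^2 := by
  have h1 : 1 + w ≤ Real.exp w := by linarith [Real.add_one_le_exp w]
  have h2 : Real.exp (-w) * Real.exp w = 1 := by rw [← Real.exp_add]; simp
  have h3 : 0 < Real.exp (-w) := Real.exp_pos _
  have h4 : Real.exp (-w) * (1 + w) ≤ 1 := by nlinarith
  have h5 : 0 ≤ w^3 := by positivity
  have h6 : Real.exp (-w) * (1 + w) ≤ (1 - w + w^2) * (1 + w) := by nlinarith
  exact le_of_mul_le_mul_right h6 (by linarith)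

lemma aux_s (t : ℝ) (ht : 0 < t) : 0 ≤ 1 - Real.exp (-t) ∧ 1 - Real.exp (-t) ≤ t ∧
    t - t^2 ≤ 1 - Real.exp (-t) := by
  refine ⟨?_, ?_, ?_⟩
  · have := Real.exp_le_one_iff.2 (by linarith : -t ≤ 0); linarith
  · linarith [Real.add_one_le_exp (-t)]
  · linarith [aux_exp t ht.le]

lemma aux_G (s u : ℝ) (hs : 0 ≤ s) (hu : 0 ≤ u) : 0 ≤ 1 - Real.exp (-(u * s)) ∧
    1 - Real.exp (-(u * s)) ≤ u * s ∧ u * s - (u*s)^2 ≤ 1 - Real.exp (-(u * s)) := by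
  have hw : 0 ≤ u * s := by positivity
  refine ⟨?_, ?_, ?_⟩
  · have := Real.exp_le_one_iff.2 (by linarith : -(u*s) ≤ 0); linarith
  · linarith [Real.add_one_le_exp (-(u*s))]
  · linarith [aux_exp (u*s) hw]

lemma aux_key (t u : ℝ) (ht : 0 < t) (hu : 0 ≤ u) :
    |(1 - Real.exp (-(u * (1 - Real.exp (-t))))) - t * u| ≤ t^2 * (u + u^2) := by
  obtain ⟨a, b, c⟩ := aux_s t ht
  obtain ⟨a', b', c'⟩ := aux_G _ u a hu
  set s := 1 - Real.exp (-t)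
  have h1 : u * s ≤ u * t := by gcongr
  have h2 : u * (t - t^2) ≤ u * s := by gcongr
  have h3 : (u * s)^2 ≤ (u * t)^2 := by gcongr
  have : 0 ≤ t^2 * (u + u^2) := by positivity
  rw [abs_le]; constructor <;> nlinarith

lemma aux_int (g : ℝ → ℝ) (hg : Continuous g) (C a : ℝ) (h : ∀ y, |g y| ≤ C * Real.exp (-y)) :
    IntegrableOn g (Set.Ioi a) :=
  Integrable.mono' ((integrableOn_exp_neg_Ioi a).const_mul C) hg.aestronglyMeasurable
    (Filter.Eventually.of_forall h)

lemma aux_lim (g : ℝ → ℝ) (C : ℝ) (h : ∀ y, |g y| ≤ C * Real.exp (-y)) :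
    Filter.Tendsto g Filter.atTop (nhds 0) := by
  apply squeeze_zero_norm h
  simpa using (Real.tendsto_exp_neg_atTop_nhds_zero).const_mul C

lemma aux_P (f : ℝ → ℝ) (hd : Differentiable ℝ f) (hc : Continuous (deriv f)) (M M1 : ℝ)
    (hM : ∀ x, |f x| ≤ M) (hM1 : ∀ x, |deriv f x| ≤ M1) (s a : ℝ) (hs : 0 ≤ s) :
    (∫ y in Set.Ioi a, f y * Real.exp (-(Real.exp (-y) * s)) * (Real.exp (-y) * s))
      + f a * Real.exp (-(Real.exp (-a) * s))
    = f a + ∫ y in Set.Ioi a, deriv f y * (1 - Real.exp (-(Real.exp (-y) * s))) := by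
  have hM0 : 0 ≤ M := (abs_nonneg _).trans (hM 0)
  have hM10 : 0 ≤ M1 := (abs_nonneg _).trans (hM1 0)
  have fc := hd.continuous
  have hG : ∀ y, |1 - Real.exp (-(Real.exp (-y) * s))| ≤ s * Real.exp (-y) := fun y => by
    obtain ⟨a1, a2, a3⟩ := aux_G s (Real.exp (-y)) hs (Real.exp_pos _).le
    rw [abs_of_nonneg a1]; linarith
  have i1 : IntegrableOn (fun y => f y * Real.exp (-(Real.exp (-y) * s)) * (Real.exp (-y) * s))
      (Set.Ioi a) := by
    apply aux_int _ (by fun_prop) (M * s)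
    intro y
    rw [abs_mul, abs_mul, Real.abs_exp, abs_of_nonneg (by positivity : 0 ≤ Real.exp (-y) * s)]
    have : Real.exp (-(Real.exp (-y) * s)) ≤ 1 := Real.exp_le_one_iff.2 (by
      have : 0 ≤ Real.exp (-y) * s := by positivity
      linarith)
    calc _ ≤ M * 1 * (Real.exp (-y) * s) := by gcongr; exact hM y
      _ = _ := by ring
  have i2 : IntegrableOn (fun y => deriv f y * (1 - Real.exp (-(Real.exp (-y) * s))))
      (Set.Ioi a) := by
    apply aux_int _ (by fun_prop) (M1 * s)
    intro y
    rw [abs_mul, mul_assoc]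
    gcongr
    · exact hM1 y
    · exact hG y
  have hder : ∀ y, HasDerivAt (fun y => f y * (1 - Real.exp (-(Real.exp (-y) * s))))
      (deriv f y * (1 - Real.exp (-(Real.exp (-y) * s)))
        - f y * Real.exp (-(Real.exp (-y) * s)) * (Real.exp (-y) * s)) y := fun y => by
    have h1 : HasDerivAt (fun y : ℝ => Real.exp (-y)) (Real.exp (-y) * (-1)) y :=
      (hasDerivAt_id y).neg.exp
    have h2 := ((h1.mul_const s).fun_neg.exp).const_sub 1
    exact ((hd y).hasDerivAt.mul h2).congr_deriv (by ring)
  have hl : Filter.Tendsto (fun y => f y * (1 - Real.exp (-(Real.exp (-y) * s))))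
      Filter.atTop (nhds 0) := by
    apply aux_lim _ (M * s)
    intro y
    rw [abs_mul, mul_assoc]
    gcongr
    · exact hM y
    · exact hG y
  have key := integral_Ioi_of_hasDerivAt_of_tendsto' (fun y _ => hder y) (i2.sub i1) hl
  rw [integral_sub i2 i1] at key
  linarith

lemma aux_A (f : ℝ → ℝ) (hd : Differentiable ℝ f) (hc : Continuous (deriv f)) (M M1 : ℝ)
    (hM : ∀ x, |f x| ≤ M) (hM1 : ∀ x, |deriv f x| ≤ M1) (x : ℝ) :
    (∫ y in Set.Ioi x, Real.exp (-y) * (f y - f x)) =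
      ∫ y in Set.Ioi x, deriv f y * Real.exp (-y) := by
  have fc := hd.continuous
  have hb : ∀ y, |Real.exp (-y) * (f y - f x)| ≤ (2 * M) * Real.exp (-y) := fun y => by
    rw [abs_mul, Real.abs_exp, mul_comm]
    gcongr
    have := abs_sub (f y) (f x)
    linarith [hM y, hM x]
  have i1 : IntegrableOn (fun y => Real.exp (-y) * (f y - f x)) (Set.Ioi x) :=
    aux_int _ (by fun_prop) _ _ hb
  have i2 : IntegrableOn (fun y => deriv f y * Real.exp (-y)) (Set.Ioi x) := by
    apply aux_int _ (by fun_prop) M1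
    intro y
    rw [abs_mul, Real.abs_exp]
    gcongr
    exact hM1 y
  have hder : ∀ y, HasDerivAt (fun y => Real.exp (-y) * (f y - f x))
      (deriv f y * Real.exp (-y) - Real.exp (-y) * (f y - f x)) y := fun y => by
    have h1 : HasDerivAt (fun y : ℝ => Real.exp (-y)) (Real.exp (-y) * (-1)) y :=
      (hasDerivAt_id y).neg.exp
    exact (h1.mul ((hd y).hasDerivAt.sub_const (f x))).congr_deriv (by ring)
  have key := integral_Ioi_of_hasDerivAt_of_tendsto' (fun y _ => hder y) (i2.sub i1)
    (aux_lim _ _ hb)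
  rw [integral_sub i2 i1] at key
  simp only [sub_self, mul_zero] at key
  linarith

lemma aux_taylor (f : ℝ → ℝ) (hd : Differentiable ℝ f) (hd2 : Differentiable ℝ (deriv f)) (M2 : ℝ)
    (hM2 : ∀ x, |deriv (deriv f) x| ≤ M2) (x t : ℝ) (ht : 0 < t) :
    |f (x - t) - f x + t * deriv f x| ≤ M2 * t^2 := by
  have hM20 : 0 ≤ M2 := (abs_nonneg _).trans (hM2 0)
  have h1 : ∀ u, |deriv f u - deriv f x| ≤ M2 * |u - x| := fun u =>
    convex_univ.norm_image_sub_le_of_norm_deriv_le (fun y _ => hd2 y) (fun y _ => hM2 y)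
      (Set.mem_univ x) (Set.mem_univ u)
  have h2 := (convex_Icc (x - t) x).norm_image_sub_le_of_norm_hasDerivWithin_le
    (f := fun u => f u - deriv f x * u) (f' := fun u => deriv f u - deriv f x) (C := M2 * t)
    (x := x) (y := x - t)
    (fun u _ => by
      have := (hd u).hasDerivAt.sub ((hasDerivAt_id u).const_mul (deriv f x))
      simp only [mul_one] at this
      exact this.hasDerivWithinAt)
    (fun u hu => by
      refine (h1 u).trans ?_
      gcongr
      rw [abs_le]; constructor <;> linarith [hu.1, hu.2])
    ⟨by linarith, le_refl _⟩ ⟨le_refl _, by linarith⟩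
  simp only [Real.norm_eq_abs] at h2
  have e : |x - t - x| = t := by rw [sub_sub_cancel_left, abs_neg, abs_of_pos ht]
  rw [e] at h2
  calc _ = |f (x - t) - deriv f x * (x - t) - (f x - deriv f x * x)| := by congr 1; ring
    _ ≤ _ := h2
    _ = _ := by ring

/-- Generator convergence for the semigroup of the time-reversed MRCA process of the
evolving Bolthausen–Sznitman coalescent: for `f` twice continuously differentiable,
constant on a left half-line, with `f, f′, f″` bounded and vanishing at `+∞`,
`sup_x |(P_t f(x) − f(x))/t − A f(x)| → 0` as `t → 0+`, where
`P_t f(x) = ∫_{x−t}^∞ f(y) e^{−e^{−y}(1−e^{−t})} e^{−y}(1−e^{−t}) dy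
           + f(x−t) e^{−e^{−(x−t)}(1−e^{−t})}` and
`A f(x) = −f′(x) + ∫_x^∞ e^{−y}(f(y) − f(x)) dy`. -/
theorem stmt13 (f : ℝ → ℝ) (hf : ContDiff ℝ 2 f)
    (z : ℝ) (hconst : ∀ x ≤ z, f x = f z)
    (hfb : ∃ M, ∀ x, |f x| ≤ M)
    (hf'b : ∃ M, ∀ x, |deriv f x| ≤ M)
    (hf''b : ∃ M, ∀ x, |deriv (deriv f) x| ≤ M)
    (hf0 : Filter.Tendsto f Filter.atTop (nhds 0))
    (hf'0 : Filter.Tendsto (deriv f) Filter.atTop (nhds 0))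
    (hf''0 : Filter.Tendsto (deriv (deriv f)) Filter.atTop (nhds 0)) :
    ∀ ε > 0, ∃ δ > 0, ∀ t : ℝ, 0 < t → t < δ → ∀ x : ℝ,
      |((∫ y in Set.Ioi (x - t),
            f y * Real.exp (-(Real.exp (-y) * (1 - Real.exp (-t))))
              * (Real.exp (-y) * (1 - Real.exp (-t))))
          + f (x - t) * Real.exp (-(Real.exp (-(x - t)) * (1 - Real.exp (-t))))
          - f x) / t
        - (-(deriv f x) + ∫ y in Set.Ioi x, Real.exp (-y) * (f y - f x))| < ε := by
  obtain ⟨M, hM⟩ := hfb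
  obtain ⟨M1, hM1⟩ := hf'b
  obtain ⟨M2, hM2⟩ := hf''b
  have hd : Differentiable ℝ f := hf.differentiable (by norm_num)
  have hcd : ContDiff ℝ 1 (deriv f) := by
    have : ContDiff ℝ (1 + 1) f := by norm_num; exact hf
    exact (contDiff_succ_iff_deriv.1 this).2.2
  have hd2 : Differentiable ℝ (deriv f) := hcd.differentiable (by norm_num)
  have hc : Continuous (deriv f) := hd2.continuous
  have hM10 : 0 ≤ M1 := (abs_nonneg _).trans (hM1 0)
  have hM20 : 0 ≤ M2 := (abs_nonneg _).trans (hM2 0)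
  have hz : ∀ y < z, deriv f y = 0 := fun y hy => by
    have : f =ᶠ[nhds y] fun _ => f z := by
      filter_upwards [Iio_mem_nhds hy] with u hu using hconst u (le_of_lt hu)
    rw [this.deriv_eq, deriv_const]
  set H : ℝ → ℝ := fun y => |deriv f y| * (Real.exp (-y) + Real.exp (-y)^2) with hH
  have hHc : Continuous H := by fun_prop
  have hHi : Integrable H := by
    have hs : Function.support H ⊆ Set.Ici z := by
      intro y hy
      by_contra h
      exact hy (by simp [hH, hz y (not_le.1 h)])
    rw [← integrableOn_iff_integrable_of_support_subset hs, integrableOn_Ici_iff_integrableOn_Ioi]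
    refine Integrable.mono' ((integrableOn_exp_neg_Ioi z).const_mul (M1 * (1 + Real.exp (-z))))
      hHc.aestronglyMeasurable ?_
    filter_upwards [ae_restrict_mem measurableSet_Ioi] with y hy
    have hy' : Real.exp (-y) ≤ Real.exp (-z) := Real.exp_le_exp.2 (neg_le_neg (le_of_lt hy))
    rw [Real.norm_eq_abs, abs_of_nonneg (by positivity)]
    calc _ = |deriv f y| * (1 + Real.exp (-y)) * Real.exp (-y) := by simp only [hH]; ring
      _ ≤ _ := by gcongr; exact hM1 y
  set B := ∫ y, H y with hB
  have hB0 : 0 ≤ B := integral_nonneg (fun y => by positivity)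
  have hK : ∀ y, |deriv f y| * Real.exp (-y) ≤ M1 * Real.exp (-z) := fun y => by
    rcases lt_or_ge y z with h | h
    · rw [hz y h]; simp; positivity
    · gcongr
      exact hM1 y
  set K := M1 * Real.exp (-z) with hKd
  have hK0 : 0 ≤ K := by positivity
  intro ε hε
  refine ⟨ε / (M2 + K + B + 1), by positivity, fun t ht htδ x => ?_⟩
  rw [lt_div_iff₀ (by positivity)] at htδ
  obtain ⟨s0, s1, s2⟩ := aux_s t ht
  rw [aux_P f hd hc M M1 hM hM1 _ _ s0, aux_A f hd hc M M1 hM hM1]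
  set g : ℝ → ℝ := fun y => deriv f y * (1 - Real.exp (-(Real.exp (-y) * (1 - Real.exp (-t)))))
    with hg
  have hgc : Continuous g := by fun_prop
  have hG : ∀ y, |g y| ≤ t * (|deriv f y| * Real.exp (-y)) := fun y => by
    obtain ⟨a1, a2, a3⟩ := aux_G _ (Real.exp (-y)) s0 (Real.exp_pos _).le
    rw [hg, abs_mul, abs_of_nonneg a1]
    calc _ ≤ |deriv f y| * (Real.exp (-y) * t) := by
          gcongr
          refine a2.trans ?_
          gcongr
      _ = _ := by ring
  have gi : ∀ a, IntegrableOn g (Set.Ioi a) := fun a => by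
    apply aux_int _ hgc (t * M1)
    intro y
    refine (hG y).trans ?_
    rw [mul_assoc]
    gcongr
    exact hM1 y
  have i2 : IntegrableOn (fun y => deriv f y * Real.exp (-y)) (Set.Ioi x) := by
    apply aux_int _ (by fun_prop) M1
    intro y
    rw [abs_mul, Real.abs_exp]
    gcongr
    exact hM1 y
  have hsplit : ∫ y in Set.Ioi (x - t), g y =
      (∫ y in Set.Ioc (x - t) x, g y) + ∫ y in Set.Ioi x, g y := by
    rw [← Set.Ioc_union_Ioi_eq_Ioi (by linarith : x - t ≤ x)]
    exact setIntegral_union (Set.Ioc_disjoint_Ioi le_rfl) measurableSet_Ioi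
      ((gi (x - t)).mono_set Set.Ioc_subset_Ioi_self) (gi x)
  have e1 : |∫ y in Set.Ioc (x - t) x, g y| ≤ K * t ^ 2 := by
    have := norm_setIntegral_le_of_norm_le_const (μ := volume) (s := Set.Ioc (x - t) x) (f := g)
      (C := t * K) (by simp) (fun y _ => (hG y).trans (by gcongr; exact hK y))
    rw [Real.norm_eq_abs] at this
    refine this.trans (le_of_eq ?_)
    rw [measureReal_def, Real.volume_Ioc, ENNReal.toReal_ofReal (by linarith)]
    ring
  have e2 : |(∫ y in Set.Ioi x, g y) - t * ∫ y in Set.Ioi x, deriv f y * Real.exp (-y)|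
      ≤ B * t ^ 2 := by
    rw [← integral_const_mul, ← integral_sub (gi x) (i2.const_mul t)]
    calc _ ≤ ∫ y in Set.Ioi x, t ^ 2 * H y := by
          rw [← Real.norm_eq_abs]
          refine norm_integral_le_of_norm_le (hHi.const_mul _).integrableOn
            (Filter.Eventually.of_forall fun y => ?_)
          have := aux_key t (Real.exp (-y)) ht (Real.exp_pos _).le
          calc _ = |deriv f y| * |(1 - Real.exp (-(Real.exp (-y) * (1 - Real.exp (-t)))))
                  - t * Real.exp (-y)| := by
                rw [← abs_mul, Real.norm_eq_abs]; congr 1; simp only [hg]; ring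
            _ ≤ |deriv f y| * (t^2 * (Real.exp (-y) + Real.exp (-y)^2)) := by gcongr
            _ = _ := by simp only [hH]; ring
      _ ≤ ∫ y, t ^ 2 * H y := setIntegral_le_integral (hHi.const_mul _)
            (Filter.Eventually.of_forall fun y => by simp only [hH]; positivity)
      _ = _ := by rw [integral_const_mul]; ring
  have e3 := aux_taylor f hd hd2 M2 hM2 x t ht
  rw [hsplit]
  set I1 := ∫ y in Set.Ioc (x - t) x, g y
  set I2 := ∫ y in Set.Ioi x, g y
  set I3 := ∫ y in Set.Ioi x, deriv f y * Real.exp (-y)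
  have eq : (f (x - t) + (I1 + I2) - f x) / t - (-deriv f x + I3) =
      ((f (x - t) - f x + t * deriv f x) + I1 + (I2 - t * I3)) / t := by
    field_simp
    ring
  rw [eq, abs_div, abs_of_pos ht, div_lt_iff₀ ht]
  calc _ ≤ |f (x - t) - f x + t * deriv f x| + |I1| + |I2 - t * I3| := abs_add_three _ _ _
    _ ≤ M2 * t^2 + K * t^2 + B * t^2 := by gcongr
    _ ≤ t * (M2 + K + B + 1) * t := by nlinarith [sq_nonneg t]
    _ < ε * t := by gcongr
end

section
/- For every real z > 0, ∫_{−∞}^{0} (∫_{0}^{∞} 1{e^{−s} y ≤ −z} ds) · y^{−2} dy = 1/z. -/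
open MeasureTheory Filter Topology in
theorem outer15 (z : ℝ) (hz : 0 < z) :
    ∫ x in Set.Ioi z, Real.log (x / z) / x ^ 2 = 1 / z := by
  have h := integral_Ioi_of_hasDerivAt_of_nonneg' (a := z) (l := 0)
    (g := fun x => -((Real.log x - Real.log z + 1) / x))
    (g' := fun x => Real.log (x / z) / x ^ 2) ?_ ?_ ?_
  · rw [h]; simp
  · intro x hx
    have hx0 : 0 < x := lt_of_lt_of_le hz hx
    have := ((((Real.hasDerivAt_log hx0.ne').sub_const (Real.log z)).add_const 1).div
      (hasDerivAt_id x) hx0.ne').neg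
    refine this.congr_deriv ?_
    rw [Real.log_div hx0.ne' hz.ne']
    simp only [id]
    field_simp
    ring
  · intro x hx
    have hx' : z < x := hx
    have : 0 ≤ Real.log (x / z) := Real.log_nonneg (by rw [le_div_iff₀ hz]; linarith)
    positivity
  · have h1 : Tendsto (fun x : ℝ => Real.log x / x) atTop (𝓝 0) :=
      Real.isLittleO_log_id_atTop.tendsto_div_nhds_zero
    have h2 : Tendsto (fun x : ℝ => (1 - Real.log z) / x) atTop (𝓝 0) :=
      tendsto_const_nhds.div_atTop tendsto_id
    have h3 := (h1.add h2).neg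
    simp only [add_zero, neg_zero] at h3
    refine h3.congr fun x => ?_
    ring

open MeasureTheory in
theorem inner15 (z : ℝ) (hz : 0 < z) (x : ℝ) (hx : 0 < x) :
    (∫ s in Set.Ioi (0:ℝ), if Real.exp (-s) * (-x) ≤ -z then (1:ℝ) else 0)
      = max (Real.log (x / z)) 0 := by
  have e : (fun s : ℝ => if Real.exp (-s) * (-x) ≤ -z then (1:ℝ) else 0)
      = (Set.Iic (Real.log (x / z))).indicator (fun _ => (1:ℝ)) := by
    funext s
    have : Real.exp (-s) * (-x) ≤ -z ↔ s ∈ Set.Iic (Real.log (x / z)) := by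
      rw [Set.mem_Iic, Real.le_log_iff_exp_le (by positivity), le_div_iff₀ hz, Real.exp_neg,
        mul_neg, neg_le_neg_iff, inv_mul_eq_div, le_div_iff₀ (Real.exp_pos s), mul_comm]
    simp only [Set.indicator, this]
  rw [e, setIntegral_indicator measurableSet_Iic, Set.Ioi_inter_Iic]
  simp [Measure.real, ENNReal.toReal_ofReal']

/-- For every `z > 0`,
`∫_{−∞}^{0} (∫_{0}^{∞} 1{e^{−s} y ≤ −z} ds) · y^{−2} dy = 1/z`. -/
theorem stmt15 (z : ℝ) (hz : 0 < z) :
    ∫ y in Set.Iio (0:ℝ),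
        (∫ s in Set.Ioi (0:ℝ), if Real.exp (-s) * y ≤ -z then (1:ℝ) else 0) / y ^ 2
      = 1 / z := by
  have h := integral_comp_neg_Ioi (0:ℝ) (fun y : ℝ =>
    (∫ s in Set.Ioi (0:ℝ), if Real.exp (-s) * y ≤ -z then (1:ℝ) else 0) / y ^ 2)
  rw [neg_zero, MeasureTheory.integral_Iic_eq_integral_Iio] at h
  rw [← h, ← outer15 z hz]
  have e : Set.Ioi z = Set.Ioi 0 ∩ Set.Ioi z := by
    ext x; simp only [Set.mem_inter_iff, Set.mem_Ioi]
    exact ⟨fun h => ⟨hz.trans h, h⟩, fun h => h.2⟩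
  rw [e, ← MeasureTheory.setIntegral_indicator measurableSet_Ioi]
  refine MeasureTheory.setIntegral_congr_fun measurableSet_Ioi fun x hx => ?_
  have hx0 : 0 < x := hx
  simp only [inner15 z hz x hx0, neg_sq]
  by_cases hxz : z < x
  · rw [Set.indicator_of_mem (show x ∈ Set.Ioi z from hxz), max_eq_left]
    exact Real.log_nonneg (by rw [le_div_iff₀ hz]; linarith)
  · rw [Set.indicator_of_notMem (show x ∉ Set.Ioi z from hxz), max_eq_right, zero_div]
    exact Real.log_nonpos (by positivity) (by rw [div_le_iff₀ hz]; linarith)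
end

section
/- For every real u ≠ 0, the Lebesgue integral ∫_{−∞}^{0} (1 − e^{iux} + iux·1{|x| ≤ 1}) x^{−2} dx (of a complex-valued, absolutely integrable function) equals (π/2)|u| − iu·log|u| + iu(1 − γ), where γ denotes Euler's constant. -/
open MeasureTheory Set Filter Topology

noncomputable def lkK (z : ℂ) (y : ℝ) : ℂ :=
  (1 - Complex.exp (-z * y) - (if y ≤ 1 then z * y else 0)) / (y : ℂ) ^ 2

noncomputable def lkB (M : ℝ) (y : ℝ) : ℝ := if y ≤ 1 then 3 * M ^ 2 else 2 * y ^ (-2 : ℝ)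

noncomputable def lkD (z : ℂ) (y : ℝ) : ℂ :=
  (Complex.exp (-z * y) - (if y ≤ 1 then 1 else 0)) / (y : ℂ)

lemma lk_norm_exp {w : ℂ} (hw : 0 ≤ w.re) : ‖Complex.exp (-w)‖ ≤ 1 := by
  rw [Complex.norm_exp]; simpa using hw

lemma lk_exp_bound2 {w : ℂ} (hw : 0 ≤ w.re) : ‖1 - Complex.exp (-w) - w‖ ≤ 3 * ‖w‖ ^ 2 := by
  by_cases h : ‖w‖ ≤ 1
  · have := Complex.norm_exp_sub_one_sub_id_le (x := -w) (by simpa using h)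
    rw [← norm_neg] at this
    have e : -(Complex.exp (-w) - 1 - -w) = 1 - Complex.exp (-w) - w := by ring
    rw [e, norm_neg] at this
    nlinarith [sq_nonneg ‖w‖]
  · have h1 := lk_norm_exp hw
    have h2 : ‖1 - Complex.exp (-w) - w‖ ≤ ‖(1:ℂ)‖ + ‖Complex.exp (-w)‖ + ‖w‖ :=
      (norm_sub_le _ _).trans (by gcongr; exact norm_sub_le _ _)
    rw [norm_one] at h2
    push Not at h
    nlinarith

lemma lk_exp_bound1 {w : ℂ} (hw : 0 ≤ w.re) : ‖Complex.exp (-w) - 1‖ ≤ 3 * ‖w‖ := by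
  by_cases h : ‖w‖ ≤ 1
  · have := Complex.norm_exp_sub_one_le (x := -w) (by simpa using h)
    rw [norm_neg] at this
    linarith [norm_nonneg w]
  · have h1 := lk_norm_exp hw
    have h2 : ‖Complex.exp (-w) - 1‖ ≤ ‖Complex.exp (-w)‖ + ‖(1:ℂ)‖ := norm_sub_le _ _
    rw [norm_one] at h2
    push Not at h
    linarith

lemma lk_re_nonneg {z : ℂ} (hz : 0 ≤ z.re) {y : ℝ} (hy : 0 < y) : 0 ≤ (z * y).re := by
  simp; positivity

lemma lkK_bound {z : ℂ} {M : ℝ} (hz : 0 ≤ z.re) (hM : ‖z‖ ≤ M) {y : ℝ} (hy : 0 < y) :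
    ‖lkK z y‖ ≤ lkB M y := by
  have hw := lk_re_nonneg hz hy
  unfold lkK lkB
  rw [norm_div, norm_pow, Complex.norm_real, Real.norm_of_nonneg hy.le, neg_mul]
  split_ifs with h
  · rw [div_le_iff₀ (by positivity)]
    refine (lk_exp_bound2 hw).trans ?_
    rw [norm_mul, Complex.norm_real, Real.norm_of_nonneg hy.le]
    have := norm_nonneg z
    calc 3 * (‖z‖ * y) ^ 2 = 3 * ‖z‖ ^ 2 * y ^ 2 := by ring
      _ ≤ _ := by gcongr
  · rw [sub_zero, Real.rpow_neg hy.le, ← div_eq_mul_inv]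
    have : ‖1 - Complex.exp (-(z * y))‖ ≤ 2 := by
      refine (norm_sub_le _ _).trans ?_
      rw [norm_one]; linarith [lk_norm_exp hw]
    norm_cast
    gcongr

lemma lkB_int (M : ℝ) : IntegrableOn (lkB M) (Ioi 0) := by
  rw [← Ioc_union_Ioi_eq_Ioi (zero_le_one (α := ℝ))]
  refine IntegrableOn.union ?_ ?_
  · refine IntegrableOn.congr_fun (f := fun _ => 3 * M ^ 2) ?_ ?_ measurableSet_Ioc
    · exact integrableOn_const (by simp)
    · intro y hy; simp [lkB, hy.2]
  · refine IntegrableOn.congr_fun (f := fun y => 2 * y ^ (-2 : ℝ)) ?_ ?_ measurableSet_Ioi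
    · exact (integrableOn_Ioi_rpow_of_lt (by norm_num) one_pos).const_mul 2
    · intro y hy; simp [lkB, not_le.2 (mem_Ioi.1 hy)]

lemma lkK_meas (z : ℂ) : Measurable (lkK z) := by
  unfold lkK
  refine Measurable.div (Measurable.sub (by fun_prop) ?_) (by fun_prop)
  exact Measurable.ite measurableSet_Iic (by fun_prop) measurable_const

lemma lkD_meas (z : ℂ) : Measurable (lkD z) := by
  unfold lkD
  refine Measurable.div (Measurable.sub (by fun_prop) ?_) (by fun_prop)
  exact Measurable.ite measurableSet_Iic (by fun_prop) measurable_const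

lemma lkK_int {z : ℂ} (hz : 0 ≤ z.re) : IntegrableOn (lkK z) (Ioi 0) := by
  refine (lkB_int ‖z‖).mono' (lkK_meas z).aestronglyMeasurable ?_
  filter_upwards [ae_restrict_mem measurableSet_Ioi] with y hy
  exact lkK_bound hz le_rfl hy

lemma lk_diff {z : ℂ} (hz : 0 < z.re) :
    DifferentiableAt ℂ (fun z => ∫ y in Ioi (0:ℝ), lkK z y) z := by
  set r := z.re / 2 with hr
  have hr0 : 0 < r := by positivity
  have hball : ∀ w ∈ Metric.ball z r, r ≤ w.re ∧ ‖w‖ ≤ ‖z‖ + r := by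
    intro w hw
    rw [mem_ball_iff_norm] at hw
    have h1 := Complex.abs_re_le_norm (w - z)
    have h2 := norm_le_norm_add_norm_sub' w z
    rw [Complex.sub_re] at h1
    have := (abs_le.1 h1).1
    constructor <;> linarith
  have hb : IntegrableOn (fun y : ℝ => if y ≤ 1 then 3 * (‖z‖ + r) else Real.exp (-r * y)) (Ioi 0) := by
    rw [← Ioc_union_Ioi_eq_Ioi (zero_le_one (α := ℝ))]
    refine IntegrableOn.union ?_ ?_
    · refine IntegrableOn.congr_fun (f := fun _ => 3 * (‖z‖ + r)) ?_ ?_ measurableSet_Ioc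
      · exact integrableOn_const (by simp)
      · intro y hy; simp [hy.2]
    · refine IntegrableOn.congr_fun (f := fun y => Real.exp (-r * y)) ?_ ?_ measurableSet_Ioi
      · exact integrableOn_exp_mul_Ioi (by linarith) 1
      · intro y hy; simp [not_le.2 (mem_Ioi.1 hy)]
  refine (hasDerivAt_integral_of_dominated_loc_of_deriv_le (F' := lkD) (Metric.ball_mem_nhds z hr0)
    (.of_forall fun w => (lkK_meas w).aestronglyMeasurable) (lkK_int hz.le)
    (lkD_meas z).aestronglyMeasurable ?_ hb ?_).2.differentiableAt
  · filter_upwards [ae_restrict_mem measurableSet_Ioi] with y hy w hw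
    obtain ⟨h1, h2⟩ := hball w hw
    have hy' : 0 < y := hy
    have hre := lk_re_nonneg (hr0.le.trans h1) hy'
    unfold lkD
    rw [norm_div, Complex.norm_real, Real.norm_of_nonneg hy'.le, neg_mul, div_le_iff₀ hy']
    split_ifs with h
    · refine (lk_exp_bound1 hre).trans ?_
      rw [norm_mul, Complex.norm_real, Real.norm_of_nonneg hy'.le, ← mul_assoc]
      gcongr
    · push Not at h
      rw [sub_zero, Complex.norm_exp]
      have : (-(w * y)).re ≤ -r * y := by
        simp; nlinarith
      calc _ ≤ Real.exp (-r * y) := Real.exp_le_exp.2 this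
        _ ≤ _ := le_mul_of_one_le_right (Real.exp_pos _).le h.le
  · filter_upwards [ae_restrict_mem measurableSet_Ioi] with y hy w hw
    have hy' : (y:ℂ) ≠ 0 := by exact_mod_cast (ne_of_gt (mem_Ioi.1 hy))
    unfold lkK lkD
    have he : HasDerivAt (fun w : ℂ => Complex.exp (-w * y)) (Complex.exp (-w * y) * (-1 * y)) w :=
      (((hasDerivAt_id w).neg).mul_const (y:ℂ)).cexp
    have hi : HasDerivAt (fun w : ℂ => if y ≤ 1 then w * (y:ℂ) else 0) (if y ≤ 1 then 1 * (y:ℂ) else 0) w := by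
      split_ifs
      · exact (hasDerivAt_id w).mul_const _
      · exact hasDerivAt_const _ _
    convert! ((he.const_sub 1).sub hi).div_const ((y:ℂ)^2) using 1
    split_ifs <;> field_simp <;> ring

lemma lk_log {r : ℝ} (hr : 0 < r) :
    IntegrableOn (fun t : ℝ => (Real.log t : ℂ) * Complex.exp (-r * t)) (Ioi 0) ∧
    ∫ t in Ioi (0:ℝ), (Real.log t : ℂ) * Complex.exp (-r * t)
      = -(1 / r) * (Real.log r + Real.eulerMascheroniConstant) := by
  have hf : ContinuousOn (fun t : ℝ => Complex.exp (-r * t)) (Ioi 0) := by fun_prop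
  obtain ⟨h1, h2⟩ := mellin_hasDerivAt_of_isBigO_rpow (a := 2) (b := 0) (s := 1)
    (f := fun t : ℝ => Complex.exp (-r * t)) (hf.locallyIntegrableOn measurableSet_Ioi) (by
      refine Asymptotics.IsBigO.congr' (Asymptotics.IsBigO.norm_left
        (isLittleO_exp_neg_mul_rpow_atTop hr (-2)).isBigO) ?_ (by rfl) |>.of_norm_left
      refine .of_forall fun t => ?_
      simp [Complex.norm_exp]) (by norm_num)
    (by
      simp only [neg_zero, Real.rpow_zero]
      have : ContinuousAt (fun t : ℝ => Complex.exp (-r * t)) 0 := by fun_prop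
      exact (this.isBigO_one ℝ).mono nhdsWithin_le_nhds) (by norm_num)
  have h3 : HasDerivAt (mellin (fun t : ℝ => Complex.exp (-r * t)))
      (((1:ℂ) / r) ^ (1:ℂ) * Complex.log (1 / r) * 1 * Complex.Gamma 1
        + ((1:ℂ) / r) ^ (1:ℂ) * (-Real.eulerMascheroniConstant)) 1 := by
    have hr' : (1:ℂ) / r ≠ 0 := by simp [hr.ne']
    refine (((hasDerivAt_id (1:ℂ)).const_cpow (c := (1:ℂ) / r) (Or.inl hr')).mul
      Complex.hasDerivAt_Gamma_one).congr_of_eventuallyEq ?_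
    have : ∀ᶠ s : ℂ in 𝓝 1, 0 < s.re :=
      (Complex.continuous_re.tendsto 1).eventually (lt_mem_nhds (by simp))
    filter_upwards [this] with s hs
    simpa [mellin] using Complex.integral_cpow_mul_exp_neg_mul_Ioi hs hr
  have h4 := h2.unique h3
  simp only [MellinConvergent, mellin, sub_self, Complex.cpow_zero, one_smul, Complex.real_smul] at h1 h4
  refine ⟨h1, h4.trans ?_⟩
  rw [Complex.cpow_one, Complex.Gamma_one]
  have : Complex.log (1 / r) = -(Real.log r : ℂ) := by
    rw [Complex.ofReal_log hr.le, one_div, Complex.log_inv]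
    rw [Complex.arg_ofReal_of_nonneg hr.le]; exact Real.pi_pos.ne
  rw [this]; ring

lemma lk_deriv (c : ℂ) (r : ℝ) {y : ℝ} (hy : 0 < y) :
    HasDerivAt (fun y : ℝ => -((1 - Complex.exp (-r * y) - c * y) / y)
        + r * ((Complex.exp (-r * y) - c / r) * (Real.log y : ℂ)))
      ((1 - Complex.exp (-r * y) - c * y) / (y:ℂ) ^ 2 + (c - r * (c / r)) / y
        - (r:ℂ) ^ 2 * ((Real.log y : ℂ) * Complex.exp (-r * y))) y := by
  have hy' : (y:ℂ) ≠ 0 := by exact_mod_cast hy.ne'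
  have hid : HasDerivAt (fun y : ℝ => (y:ℂ)) 1 y := Complex.ofRealCLM.hasDerivAt
  have he : HasDerivAt (fun y : ℝ => Complex.exp (-r * y)) (Complex.exp (-r * y) * (-r * 1)) y :=
    (hid.const_mul (-r : ℂ)).cexp
  have hl : HasDerivAt (fun y : ℝ => (Real.log y : ℂ)) ((y⁻¹ : ℝ) : ℂ) y :=
    (Real.hasDerivAt_log hy.ne').ofReal_comp
  convert! (((he.const_sub 1).sub (hid.const_mul c)).div hid hy').neg.add
    (((he.sub_const (c / r)).mul hl).const_mul (r:ℂ)) using 1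
  simp only [Pi.sub_apply]
  push_cast
  field_simp
  ring

lemma lk_real {r : ℝ} (hr : 0 < r) :
    ∫ y in Ioi (0:ℝ), lkK r y
      = r * (1 - Real.eulerMascheroniConstant - Complex.log r) := by
  have hrc : (r:ℂ) ≠ 0 := by exact_mod_cast hr.ne'
  obtain ⟨hL, hLv⟩ := lk_log hr
  have hK : IntegrableOn (lkK r) (Ioi 0) := lkK_int (by simpa using hr.le)
  have hG : IntegrableOn (fun y : ℝ => lkK r y
      - (r:ℂ) ^ 2 * ((Real.log y : ℂ) * Complex.exp (-r * y))) (Ioi 0) := hK.sub (hL.const_mul _)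
  have hsub : ∫ y in Ioi (0:ℝ), (lkK r y
      - (r:ℂ) ^ 2 * ((Real.log y : ℂ) * Complex.exp (-r * y))) = r := by
    rw [← Ioc_union_Ioi_eq_Ioi (zero_le_one (α := ℝ)), setIntegral_union
      (Ioc_disjoint_Ioi le_rfl) measurableSet_Ioi
      (hG.mono_set Ioc_subset_Ioi_self) (hG.mono_set (Ioi_subset_Ioi zero_le_one))]
    have e1 : ∫ y in Ioc (0:ℝ) 1, (lkK r y
      - (r:ℂ) ^ 2 * ((Real.log y : ℂ) * Complex.exp (-r * y))) = -(1 - Complex.exp (-r) - r) - 0 := by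
      rw [← intervalIntegral.integral_of_le zero_le_one]
      refine intervalIntegral.integral_eq_sub_of_hasDerivAt_of_tendsto zero_lt_one
        (f := fun y : ℝ => -((1 - Complex.exp (-r * y) - r * y) / y)
        + r * ((Complex.exp (-r * y) - r / r) * (Real.log y : ℂ))) ?_ ?_ ?_ ?_
      · intro y hy
        convert! lk_deriv r r hy.1 using 1
        simp [lkK, hy.2.le, hrc]
      · rw [intervalIntegrable_iff_integrableOn_Ioc_of_le zero_le_one]
        exact hG.mono_set Ioc_subset_Ioi_self
      · have hb1 : Tendsto (fun y : ℝ => 3 * r ^ 2 * y + r * (3 * r) * |Real.log y * y|) (𝓝[>] 0) (𝓝 0) := by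
          have h1 : Tendsto (fun y : ℝ => Real.log y * y) (𝓝[>] 0) (𝓝 0) := by
            simpa using tendsto_log_mul_rpow_nhdsGT_zero (r := 1) one_pos
          have h2 : Tendsto (fun y : ℝ => y) (𝓝[>] 0) (𝓝 0) := tendsto_id.mono_left nhdsWithin_le_nhds
          simpa using (h2.const_mul (3 * r ^ 2)).add (h1.abs.const_mul (r * (3 * r)))
        refine squeeze_zero_norm' ?_ hb1
        filter_upwards [self_mem_nhdsWithin] with y hy
        have hy : 0 < y := hy
        have hre := lk_re_nonneg (z := r) (by simpa using hr.le) hy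
        have b2 := lk_exp_bound2 hre
        have b1 := lk_exp_bound1 hre
        have en : ‖(r * y : ℂ)‖ = r * y := by
          rw [norm_mul, Complex.norm_real, Complex.norm_real, Real.norm_of_nonneg hr.le,
            Real.norm_of_nonneg hy.le]
        rw [en] at b1 b2
        rw [div_self hrc, neg_mul]
        refine (norm_add_le _ _).trans (add_le_add ?_ ?_)
        · rw [norm_neg, norm_div, Complex.norm_real, Real.norm_of_nonneg hy.le, div_le_iff₀ hy]
          calc _ ≤ _ := b2
            _ = _ := by ring
        · rw [norm_mul, norm_mul, Complex.norm_real, Complex.norm_real, Real.norm_of_nonneg hr.le,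
            Real.norm_eq_abs, abs_mul, abs_of_pos hy]
          calc r * (‖Complex.exp (-(r * y)) - 1‖ * |Real.log y|)
              ≤ r * ((3 * (r * y)) * |Real.log y|) := by gcongr
            _ = _ := by ring
      · have := (lk_deriv r r zero_lt_one).continuousAt.tendsto
        simp only [Complex.ofReal_one, mul_one, div_one, Real.log_one, Complex.ofReal_zero, mul_zero, add_zero] at this
        exact this.mono_left nhdsWithin_le_nhds
    have e2 : ∫ y in Ioi (1:ℝ), (lkK r y
      - (r:ℂ) ^ 2 * ((Real.log y : ℂ) * Complex.exp (-r * y))) = 0 - -(1 - Complex.exp (-r)) := by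
      have := integral_Ioi_of_hasDerivAt_of_tendsto (a := 1) (m := 0)
        (f := fun y : ℝ => -((1 - Complex.exp (-r * y) - 0 * y) / y)
        + r * ((Complex.exp (-r * y) - 0 / r) * (Real.log y : ℂ)))
        (f' := fun y : ℝ => lkK r y
      - (r:ℂ) ^ 2 * ((Real.log y : ℂ) * Complex.exp (-r * y)))
        (lk_deriv 0 r zero_lt_one).continuousAt.continuousWithinAt ?_
        (hG.mono_set (Ioi_subset_Ioi zero_le_one)) ?_
      · rw [this]; simp
      · intro y hy
        have hy : 1 < y := hy
        convert! lk_deriv 0 r (zero_lt_one.trans hy) using 1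
        simp [lkK, not_le.2 hy]
      · have hb : Tendsto (fun y : ℝ => 2 * y⁻¹ + r * (Real.exp (-r * y) * y)) atTop (𝓝 0) := by
          have h1 : Tendsto (fun y : ℝ => Real.exp (-r * y) * y) atTop (𝓝 0) := by
            have := tendsto_rpow_mul_exp_neg_mul_atTop_nhds_zero 1 r hr
            simpa [mul_comm] using this
          simpa using (tendsto_inv_atTop_zero.const_mul (2:ℝ)).add (h1.const_mul r)
        refine squeeze_zero_norm' ?_ hb
        filter_upwards [eventually_gt_atTop 1] with y hy1
        have hy : 0 < y := zero_lt_one.trans hy1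
        have hre := lk_re_nonneg (z := r) (by simpa using hr.le) hy
        have b1 := lk_norm_exp hre
        refine (norm_add_le _ _).trans (add_le_add ?_ ?_)
        · rw [norm_neg, norm_div, Complex.norm_real, Real.norm_of_nonneg hy.le, div_eq_mul_inv, zero_mul,
            sub_zero, neg_mul]
          gcongr
          refine (norm_sub_le _ _).trans ?_
          rw [norm_one]; linarith
        · rw [norm_mul, norm_mul, Complex.norm_real, Complex.norm_real, Real.norm_of_nonneg hr.le,
            zero_div, sub_zero, Complex.norm_exp, Real.norm_of_nonneg (Real.log_nonneg hy1.le)]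
          have : (-(r:ℂ) * y).re = -r * y := by simp
          rw [this]
          gcongr
          exact (Real.log_le_self hy.le)
    rw [e1, e2]; ring
  rw [integral_sub hK (hL.const_mul _), integral_const_mul, hLv] at hsub
  rw [← Complex.ofReal_log hr.le]
  have : (r:ℂ) ^ 2 * (-(1 / r) * (Real.log r + Real.eulerMascheroniConstant)) =
    -r * (Real.log r + Real.eulerMascheroniConstant) := by field_simp
  rw [this] at hsub
  linear_combination hsub

lemma lk_complex {z : ℂ} (hz : 0 < z.re) :
    ∫ y in Ioi (0:ℝ), lkK z y
      = z * (1 - Real.eulerMascheroniConstant - Complex.log z) := by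
  have hU : IsOpen {z : ℂ | 0 < z.re} := isOpen_lt continuous_const Complex.continuous_re
  have hf : AnalyticOnNhd ℂ (fun z => ∫ y in Ioi (0:ℝ), lkK z y) {z : ℂ | 0 < z.re} :=
    DifferentiableOn.analyticOnNhd (fun w hw => (lk_diff hw).differentiableWithinAt) hU
  have hg : AnalyticOnNhd ℂ (fun z => z * (1 - Real.eulerMascheroniConstant - Complex.log z))
      {z : ℂ | 0 < z.re} := by
    refine DifferentiableOn.analyticOnNhd (fun w hw => ?_) hU
    have : DifferentiableAt ℂ Complex.log w := Complex.differentiableAt_log (Or.inl hw)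
    exact (differentiableAt_id.mul (this.const_sub _)).differentiableWithinAt
  refine hf.eqOn_of_preconnected_of_frequently_eq hg
    (convex_halfSpace_re_gt 0).isPreconnected (z₀ := 1) (by simp) ?_ hz
  have ht : Tendsto (fun r : ℝ => (r:ℂ)) (𝓝[≠] 1) (𝓝[≠] 1) := by
    refine tendsto_nhdsWithin_iff.2 ⟨?_, ?_⟩
    · exact (Complex.continuous_ofReal.tendsto' 1 1 (by simp)).mono_left nhdsWithin_le_nhds
    · filter_upwards [self_mem_nhdsWithin] with r hr
      simpa using hr
  refine ht.frequently (Eventually.frequently ?_)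
  filter_upwards [nhdsWithin_le_nhds (lt_mem_nhds (zero_lt_one (α := ℝ)))] with r hr
  exact lk_real hr

lemma lk_imag {u : ℝ} (hu : u ≠ 0) :
    ∫ y in Ioi (0:ℝ), lkK (Complex.I * u) y
      = Complex.I * u * (1 - Real.eulerMascheroniConstant - Complex.log (Complex.I * u)) := by
  have hz : Tendsto (fun e : ℝ => (e:ℂ) + Complex.I * u) (𝓝[>] 0) (𝓝 (Complex.I * u)) := by
    have : Continuous (fun e : ℝ => (e:ℂ) + Complex.I * u) := by fun_prop
    exact (this.tendsto' 0 _ (by simp)).mono_left nhdsWithin_le_nhds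
  have hs : Complex.I * u ∈ Complex.slitPlane := Or.inr (by simpa using hu)
  have hR : ContinuousAt (fun z : ℂ => z * (1 - Real.eulerMascheroniConstant - Complex.log z))
      (Complex.I * u) :=
    continuousAt_id.mul (continuousAt_const.sub (continuousAt_clog hs))
  have h1 := hR.tendsto.comp hz
  have h2 : Tendsto (fun e : ℝ => ∫ y in Ioi (0:ℝ), lkK ((e:ℂ) + Complex.I * u) y) (𝓝[>] 0)
      (𝓝 (∫ y in Ioi (0:ℝ), lkK (Complex.I * u) y)) := by
    refine tendsto_integral_filter_of_dominated_convergence (lkB (1 + |u|))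
      (.of_forall fun e => (lkK_meas _).aestronglyMeasurable) ?_ (lkB_int _) ?_
    · filter_upwards [Ioo_mem_nhdsGT (zero_lt_one (α := ℝ))] with e he
      filter_upwards [ae_restrict_mem measurableSet_Ioi] with y hy
      refine lkK_bound (by simpa using he.1.le) ?_ hy
      refine (norm_add_le _ _).trans (add_le_add ?_ ?_)
      · rw [Complex.norm_real, Real.norm_of_nonneg he.1.le]; exact he.2.le
      · simp
    · refine .of_forall fun y => ?_
      have : Continuous (fun z : ℂ => lkK z y) := by
        unfold lkK
        split_ifs <;> fun_prop
      exact (this.tendsto _).comp hz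
  refine tendsto_nhds_unique h2 (h1.congr' ?_)
  filter_upwards [self_mem_nhdsWithin] with e he
  exact (lk_complex (by simpa using he)).symm

lemma lk_logI {u : ℝ} (hu : u ≠ 0) :
    Complex.I * u * Complex.log (Complex.I * u) =
      Complex.I * u * (Real.log |u| : ℂ) - ((Real.pi / 2 * |u| : ℝ) : ℂ) := by
  rcases hu.lt_or_gt with h | h
  · have : Complex.I * (u:ℂ) = ((-u : ℝ) : ℂ) * (-Complex.I) := by push_cast; ring
    rw [this, Complex.log_ofReal_mul (by linarith) (by simp), Complex.log_neg_I, abs_of_neg h]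
    push_cast
    linear_combination -(Real.pi / 2 * u : ℂ) * Complex.I_sq
  · rw [mul_comm Complex.I, Complex.log_ofReal_mul h (by simp), Complex.log_I, abs_of_pos h]
    push_cast
    linear_combination (Real.pi / 2 * u : ℂ) * Complex.I_sq

/-- Lévy–Khintchine identity for the spectrally negative 1-stable law: for `u ≠ 0`,
the function `x ↦ (1 − e^{iux} + iux·1{|x| ≤ 1})·x^{−2}` is absolutely integrable on
`(−∞, 0)` and
`∫_{−∞}^0 (1 − e^{iux} + iux·1{|x| ≤ 1}) x^{−2} dx = (π/2)|u| − iu·log|u| + iu(1 − γ)`,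
where `γ` is the Euler–Mascheroni constant. -/
theorem stmt19 (u : ℝ) (hu : u ≠ 0) :
    MeasureTheory.IntegrableOn
        (fun x : ℝ => (1 - Complex.exp (Complex.I * u * x)
          + (if |x| ≤ 1 then Complex.I * u * x else 0)) / (x : ℂ) ^ 2)
        (Set.Iio 0) ∧
      ∫ x in Set.Iio (0:ℝ),
          (1 - Complex.exp (Complex.I * u * x)
            + (if |x| ≤ 1 then Complex.I * u * x else 0)) / (x : ℂ) ^ 2
        = ((Real.pi / 2 * |u| : ℝ) : ℂ)
            - Complex.I * (u : ℂ) * (Real.log |u| : ℂ)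
            + Complex.I * (u : ℂ) * ((1 : ℂ) - (Real.eulerMascheroniConstant : ℂ)) := by
  have key : ∀ x : ℝ, (1 - Complex.exp (Complex.I * u * x)
          + (if |x| ≤ 1 then Complex.I * u * x else 0)) / (x : ℂ) ^ 2
        = if x < 0 then lkK (Complex.I * u) (-x) else (1 - Complex.exp (Complex.I * u * x)
          + (if |x| ≤ 1 then Complex.I * u * x else 0)) / (x : ℂ) ^ 2 := by
    intro x
    split_ifs with h1 h2 h2
    all_goals first
      | rfl
      | skip
    all_goals rw [abs_of_neg ‹_›] at h1
    all_goals simp [lkK, h1]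
  have hcongr : Set.EqOn (fun x : ℝ => lkK (Complex.I * u) (-x))
      (fun x : ℝ => (1 - Complex.exp (Complex.I * u * x)
          + (if |x| ≤ 1 then Complex.I * u * x else 0)) / (x : ℂ) ^ 2) (Set.Iio 0) := by
    intro x hx
    have hx : x < 0 := hx
    simp only
    rw [key x, if_pos hx]
  constructor
  · refine IntegrableOn.congr_fun ?_ hcongr measurableSet_Iio
    have := lkK_int (z := Complex.I * u) (by simp)
    rw [← integrableOn_Ici_iff_integrableOn_Ioi] at this
    rw [← integrableOn_Iic_iff_integrableOn_Iio]
    simpa using this.comp_neg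
  · rw [← setIntegral_congr_fun measurableSet_Iio hcongr, ← integral_Iic_eq_integral_Iio,
      integral_comp_neg_Iic, neg_zero, lk_imag hu]
    linear_combination -lk_logI hu
end
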